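/- arXiv:2201.10124 — 2 statements merged into one kernel-verified Lean document; each statement's English description precedes it below -/
import Mathlib

section
/- Let α, β, μ, ν be real numbers, let z ∈ ℂ with Im z > 0, set τ := −iz (so Re τ > 0) and q := e(z) = e^{−2πτ}. Then for every s ∈ ℂ with Re s > 2, F_{ℤ²}(s;α,β;μ,ν;z) = δ(β)·𝒜(s,α,μ) + e(αμ)·((2π)^s/Γ(s))·( e^{−πis/2}·𝒮_{1−s}(β,−μ;ν,α;q) + e^{πis/2}·𝒮_{1−s}(−β,μ;−ν,−α;q) ), where 𝒜(s,α,μ) := cos(πs)·ψ(s,−α,−μ) + ψ(s,α,μ). -/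
noncomputable section

open Complex MeasureTheory
open scoped Real Classical

/-- `e(s) = exp(2 π i s)`. -/
def ee (s : ℂ) : ℂ := Complex.exp (2 * (Real.pi : ℂ) * Complex.I * s)

/-- `δ(x) = 1` if `x ∈ ℤ`, `0` otherwise. -/
def dInt (x : ℝ) : ℂ := if ∃ n : ℤ, (n : ℝ) = x then 1 else 0

/-- The Lerch zeta function `ψ(r,γ,κ) = Σ_{k ∈ ℤ, γ+k>0} e((γ+k)κ) (γ+k)^{-r}`
(a convergent series when `Re r > 1`). -/
def psiL (r : ℂ) (γ κ : ℝ) : ℂ :=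
  ∑' k : {k : ℤ // 0 < γ + (k : ℝ)},
    ee ((((γ + (k.1 : ℝ)) * κ : ℝ)) : ℂ) * (((γ + (k.1 : ℝ)) : ℝ) : ℂ) ^ (-r)

/-- The `q`-series `𝒮_r(γ,δ;κ,λ;q)`, where `q = e^{-2πt}` with `Re t > 0`, and the power
`q^{(γ+k)(δ+l)}` is interpreted as `exp (-2πt(γ+k)(δ+l))`. -/
def Scal (r : ℂ) (γ δ' κ lam : ℝ) (t : ℂ) : ℂ :=
  ∑' (k : {k : ℤ // 0 < γ + (k : ℝ)}) (l : {l : ℤ // 0 < δ' + (l : ℝ)}),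
    ee ((((γ + (k.1 : ℝ)) * κ + (δ' + (l.1 : ℝ)) * lam : ℝ)) : ℂ) *
      (((δ' + (l.1 : ℝ)) : ℝ) : ℂ) ^ (-r) *
      Complex.exp (-2 * (Real.pi : ℂ) * t * ((γ + (k.1 : ℝ) : ℝ) : ℂ) * ((δ' + (l.1 : ℝ) : ℝ) : ℂ))

/-- The generalized Eisenstein series `F_{ℤ²}(s;α,β;μ,ν;z)` (mean of the two branch
conventions), defined by an absolutely convergent series for `Re s > 2`. -/
def Fz2 (s : ℂ) (α β μ ν : ℝ) (z : ℂ) : ℂ :=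
  (∑' p : {p : ℤ × ℤ // β + (p.2 : ℝ) ≠ 0},
      ee ((((α + (p.1.1 : ℝ)) * μ + (β + (p.1.2 : ℝ)) * ν : ℝ)) : ℂ) *
        ((((α + (p.1.1 : ℝ)) : ℝ) : ℂ) + (((β + (p.1.2 : ℝ)) : ℝ) : ℂ) * z) ^ (-s)) +
  dInt β *
    ((∑' m : {m : ℤ // 0 < α + (m : ℝ)},
        ee ((((α + (m.1 : ℝ)) * μ : ℝ)) : ℂ) * (((α + (m.1 : ℝ)) : ℝ) : ℂ) ^ (-s)) +
      Complex.cos ((Real.pi : ℂ) * s) *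
        ∑' m : {m : ℤ // α + (m : ℝ) < 0},
          ee ((((α + (m.1 : ℝ)) * μ : ℝ)) : ℂ) * ((|α + (m.1 : ℝ)| : ℝ) : ℂ) ^ (-s))

/-- `𝒜(s,α,μ) = cos(πs) ψ(s,-α,-μ) + ψ(s,α,μ)`. -/
def Acal (s : ℂ) (α μ : ℝ) : ℂ :=
  Complex.cos ((Real.pi : ℂ) * s) * psiL s (-α) (-μ) + psiL s α μ

/-- `ψ(k,γ,κ)` at an integer `k`: the convergent series for `k ≥ 2`, the value
`-𝒞_{1-k}(⟨γ⟩,κ)/(1-k) - δ_{k0} δ(γ)` of the analytic continuation for `k ≤ 0`,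
and the (irrelevant) value `0` for `k = 1`; here `C` is the family of Taylor
coefficients `𝒞`. -/
def psiIntC (C : ℕ → ℂ → ℝ → ℂ) (k : ℤ) (γ κ : ℝ) : ℂ :=
  if 2 ≤ k then
    ∑' n : {n : ℤ // 0 < γ + (n : ℝ)},
      ee ((((γ + (n.1 : ℝ)) * κ : ℝ)) : ℂ) * (((γ + (n.1 : ℝ)) : ℝ) : ℂ) ^ (-k)
  else if k ≤ 0 then
    -C (1 - k).toNat ((Int.fract γ : ℝ) : ℂ) κ / ((1 : ℂ) - (k : ℂ)) -
      (if k = 0 then dInt γ else 0)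
  else 0

/-- The Bernoulli polynomial `B_j(x)` evaluated in `ℂ`. -/
def BpolyC (j : ℕ) (x : ℂ) : ℂ := Polynomial.aeval x (Polynomial.bernoulli j)

/-- Weierstrass `℘`-function with periods `(1, z)`. -/
def wpFn (z w : ℂ) : ℂ :=
  w ^ (-2 : ℤ) + ∑' p : {p : ℤ × ℤ // p ≠ (0, 0)},
    ((w - (p.1.1 : ℂ) - (p.1.2 : ℂ) * z) ^ (-2 : ℤ) -
      ((p.1.1 : ℂ) + (p.1.2 : ℂ) * z) ^ (-2 : ℤ))

/-- Weierstrass zeta function with periods `(1, z)`. -/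
def wzetaFn (z w : ℂ) : ℂ :=
  1 / w + ∑' p : {p : ℤ × ℤ // p ≠ (0, 0)},
    (1 / (w - (p.1.1 : ℂ) - (p.1.2 : ℂ) * z) + 1 / ((p.1.1 : ℂ) + (p.1.2 : ℂ) * z) +
      w / ((p.1.1 : ℂ) + (p.1.2 : ℂ) * z) ^ 2)

/-- Weierstrass sigma function with periods `(1, z)`. -/
def wsigmaFn (z w : ℂ) : ℂ :=
  w * ∏' p : {p : ℤ × ℤ // p ≠ (0, 0)},
    ((1 - w / ((p.1.1 : ℂ) + (p.1.2 : ℂ) * z)) *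
      Complex.exp (w / ((p.1.1 : ℂ) + (p.1.2 : ℂ) * z) +
        w ^ 2 / (2 * ((p.1.1 : ℂ) + (p.1.2 : ℂ) * z) ^ 2)))

/-- The `q`-Pochhammer symbol `(Z;q)_∞`. -/
def qPoch (Z q : ℂ) : ℂ := ∏' l : ℕ, (1 - Z * q ^ l)

/-- `⟨x⟩' = 1 - ⟨-x⟩`. -/
def fracP (x : ℝ) : ℝ := 1 - Int.fract (-x)

/-- The Eisenstein series `E₂`. -/
def E2cl (z : ℂ) : ℂ := 1 - 24 * ∑' l : ℕ+, (l : ℂ) * ee z ^ (l : ℕ) / (1 - ee z ^ (l : ℕ))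

/-- `a_{2k}`: `ζ(1-2k)` for `k ≠ 0` and `2ζ'(0) = -log 2π` for `k = 0`. -/
def acoef (k : ℤ) : ℂ :=
  if k = 0 then -(Real.log (2 * Real.pi) : ℂ) else riemannZeta ((1 - 2 * k : ℤ) : ℂ)

/-- The classical Eisenstein series `E_{2k}`. -/
def Ecl (k : ℤ) (z : ℂ) : ℂ :=
  1 + (2 / acoef k) * ∑' l : ℕ+, (l : ℂ) ^ (2 * k - 1) * ee z ^ (l : ℕ) / (1 - ee z ^ (l : ℕ))

/-- The bilateral Lerch zeta function `ψ_ℤ^ε(r,γ,κ) = e^{-επir} ψ(r,-γ,-κ) + ψ(r,γ,κ)`. -/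
def psiZpm (ε : ℤ) (r : ℂ) (γ κ : ℝ) : ℂ :=
  Complex.exp (-(ε : ℂ) * (Real.pi : ℂ) * Complex.I * r) * psiL r (-γ) (-κ) + psiL r γ κ

/-- Integrability of the integrand of the Gamma integral with complex rate `r`. -/
lemma integrableOn_cpow_mul_exp_neg_mul {a r : ℂ} (ha : 0 < a.re) (hr : 0 < r.re) :
    IntegrableOn (fun t : ℝ => (t : ℂ) ^ (a - 1) * Complex.exp (-(r * t))) (Set.Ioi 0) := by
  have h := integrableOn_rpow_mul_exp_neg_mul_rpow (p := 1) (s := a.re - 1) (by linarith)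
    one_pos hr
  refine Integrable.mono' h ?_ ?_
  · refine ContinuousOn.aestronglyMeasurable ?_ measurableSet_Ioi
    refine ContinuousOn.mul ?_ (by fun_prop)
    exact fun t ht => (continuousAt_ofReal_cpow_const t (a - 1)
      (Or.inr (ne_of_gt ht))).continuousWithinAt
  · refine (ae_restrict_iff' measurableSet_Ioi).mpr (Filter.Eventually.of_forall fun t ht => ?_)
    rw [norm_mul, Complex.norm_cpow_eq_rpow_re_of_pos ht, Complex.norm_exp]
    simp

/-- The Gamma integral with complex rate `r`. -/
lemma integral_cpow_mul_exp_neg_complex_mul {a r : ℂ} (ha : 0 < a.re) (hr : 0 < r.re) :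
    ∫ t : ℝ in Set.Ioi 0, (t : ℂ) ^ (a - 1) * Complex.exp (-(r * t)) =
      r ^ (-a) * Complex.Gamma a := by
  have hU : IsOpen {r : ℂ | 0 < r.re} := isOpen_lt continuous_const Complex.continuous_re
  have hF : DifferentiableOn ℂ (fun r : ℂ => ∫ t : ℝ in Set.Ioi 0,
      (t : ℂ) ^ (a - 1) * Complex.exp (-(r * t))) {r : ℂ | 0 < r.re} := by
    intro r hr
    have hr' : 0 < r.re := hr
    refine DifferentiableAt.differentiableWithinAt ?_
    have hs : {w : ℂ | r.re / 2 < w.re} ∈ nhds r :=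
      (isOpen_lt continuous_const Complex.continuous_re).mem_nhds
        (show r.re / 2 < r.re by linarith)
    have ha1 : 0 < (a + 1).re := by simp; linarith
    have hmeas : ∀ w : ℂ, 0 < w.re → AEStronglyMeasurable
        (fun t : ℝ => -((t : ℂ) ^ (a + 1 - 1) * Complex.exp (-(w * t))))
        (volume.restrict (Set.Ioi 0)) := fun w hw =>
      (integrableOn_cpow_mul_exp_neg_mul ha1 hw).aestronglyMeasurable.neg
    refine (hasDerivAt_integral_of_dominated_loc_of_deriv_le (𝕜 := ℂ)
      (μ := volume.restrict (Set.Ioi 0))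
      (F := fun (w : ℂ) (t : ℝ) => (t : ℂ) ^ (a - 1) * Complex.exp (-(w * t)))
      (F' := fun (w : ℂ) (t : ℝ) => -((t : ℂ) ^ (a + 1 - 1) * Complex.exp (-(w * t))))
      (bound := fun t : ℝ => ‖(t : ℂ) ^ (a + 1 - 1) * Complex.exp (-(((r.re / 2 : ℝ) : ℂ) * t))‖)
      hs ?_ (integrableOn_cpow_mul_exp_neg_mul ha hr') (hmeas r hr') ?_ ?_ ?_).2.differentiableAt
    · filter_upwards [hU.mem_nhds hr] with w hw
      exact (integrableOn_cpow_mul_exp_neg_mul ha hw).aestronglyMeasurable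
    · refine (ae_restrict_iff' measurableSet_Ioi).mpr (Filter.Eventually.of_forall fun t ht w hw => ?_)
      rw [norm_neg, norm_mul, norm_mul]
      gcongr
      rw [Complex.norm_exp, Complex.norm_exp]
      have h1 : r.re / 2 * t ≤ w.re * t :=
        mul_le_mul_of_nonneg_right (le_of_lt hw) (le_of_lt ht)
      simpa using h1
    · exact (integrableOn_cpow_mul_exp_neg_mul ha1 (by simpa using hr')).norm
    · refine (ae_restrict_iff' measurableSet_Ioi).mpr (Filter.Eventually.of_forall fun t ht w hw => ?_)
      have ht0 : (t : ℂ) ≠ 0 := by exact_mod_cast (ne_of_gt ht)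
      have h1 : HasDerivAt (fun w : ℂ => Complex.exp (-(w * t)))
          (Complex.exp (-(w * t)) * -(1 * t)) w :=
        ((hasDerivAt_id w).mul_const (t : ℂ)).neg.cexp
      refine (h1.const_mul _).congr_deriv ?_
      rw [add_sub_right_comm, cpow_add _ _ ht0, cpow_one]
      ring
  have hG : DifferentiableOn ℂ (fun r : ℂ => r ^ (-a) * Complex.Gamma a) {r : ℂ | 0 < r.re} := by
    intro r hr
    exact ((differentiableAt_id.cpow (differentiableAt_const _)
      (Or.inl hr)).mul_const _).differentiableWithinAt
  have hconn : IsPreconnected {r : ℂ | 0 < r.re} := (convex_halfSpace_re_gt 0).isPreconnected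
  refine (hF.analyticOnNhd hU).eqOn_of_preconnected_of_frequently_eq (hG.analyticOnNhd hU) hconn
    (z₀ := 1) (by simp) ?_ hr
  have htend : Filter.Tendsto (fun x : ℝ => (x : ℂ)) (nhdsWithin 1 {1}ᶜ) (nhdsWithin 1 {1}ᶜ) := by
    refine tendsto_nhdsWithin_iff.mpr ⟨?_, ?_⟩
    · exact (Complex.continuous_ofReal.tendsto' 1 1 (by simp)).mono_left nhdsWithin_le_nhds
    · filter_upwards [self_mem_nhdsWithin] with x hx
      simpa using hx
  refine htend.frequently (Filter.Eventually.frequently ?_)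
  filter_upwards [nhdsWithin_le_nhds (lt_mem_nhds (zero_lt_one (α := ℝ)))] with x hx
  rw [Complex.integral_cpow_mul_exp_neg_mul_Ioi ha hx, one_div, inv_cpow, cpow_neg]
  rw [Complex.arg_ofReal_of_nonneg hx.le]
  exact Real.pi_pos.ne

/-- Comparison of the norm of a complex power with a real power of the norm. -/
lemma norm_cpow_neg_le (u s : ℂ) (hu : u ≠ 0) :
    ‖u ^ (-s)‖ ≤ Real.exp (π * |s.im|) * ‖u‖ ^ (-s.re) := by
  rw [Complex.norm_cpow_of_ne_zero hu, div_eq_mul_inv, ← Real.exp_neg, mul_comm, Complex.neg_re]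
  gcongr
  calc -(u.arg * (-s).im) ≤ |u.arg * s.im| := by simpa using le_abs_self (u.arg * s.im)
    _ = |u.arg| * |s.im| := abs_mul _ _
    _ ≤ π * |s.im| := by gcongr; exact Complex.abs_arg_le_pi u

/-- In the upper half plane, the real coordinates `a`, `b` are bounded by `‖a + b z‖`. -/
lemma exists_abs_le_norm_add_mul (z : ℂ) (hz : 0 < z.im) :
    ∃ K : ℝ, 0 < K ∧ ∀ a b : ℝ, |a| ≤ K * ‖(a : ℂ) + b * z‖ ∧ |b| ≤ K * ‖(a : ℂ) + b * z‖ := by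
  refine ⟨1 + (1 + ‖z‖) / z.im, by positivity, fun a b => ?_⟩
  set N := ‖(a : ℂ) + b * z‖
  have hN : 0 ≤ N := norm_nonneg _
  have hb : |b| ≤ N / z.im := by
    rw [le_div_iff₀ hz]
    calc |b| * z.im = |((a : ℂ) + b * z).im| := by simp [abs_mul, abs_of_pos hz]
      _ ≤ N := Complex.abs_im_le_norm _
  have ha : |a| ≤ N + |b| * ‖z‖ := by
    have h := norm_sub_le ((a : ℂ) + b * z) (b * z)
    simpa using h
  have hz0 : 0 ≤ ‖z‖ / z.im * N := by positivity
  have hN0 : 0 ≤ N / z.im := by positivity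
  have hprod : |b| * ‖z‖ ≤ N / z.im * ‖z‖ := by gcongr
  have e : (1 + (1 + ‖z‖) / z.im) * N = N + N / z.im + N / z.im * ‖z‖ := by ring
  have e' : ‖z‖ / z.im * N = N / z.im * ‖z‖ := by ring
  rw [e]
  constructor <;> linarith

/-- Absolute convergence of the shifted Eisenstein series for `Re s > 2`. -/
lemma summable_norm_eisenstein (α β : ℝ) (z : ℂ) (hz : 0 < z.im) (s : ℂ) (hs : 2 < s.re) :
    Summable fun p : ℤ × ℤ => if β + (p.1 : ℝ) ≠ 0 then
      ‖(((α + (p.2 : ℝ) : ℝ) : ℂ) + ((β + (p.1 : ℝ) : ℝ) : ℂ) * z) ^ (-s)‖ else 0 := by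
  obtain ⟨K, hK, hbound⟩ := exists_abs_le_norm_add_mul z hz
  have hA : Summable fun m : ℤ => 1 / |m + α| ^ (s.re / 2) + if α + (m : ℝ) = 0 then 1 else 0 := by
    refine ((Real.summable_one_div_int_add_rpow α _).mpr (by linarith)).add ?_
    refine summable_of_hasFiniteSupport (Set.Subsingleton.finite ?_)
    intro m hm n hn
    simp only [Function.mem_support, ne_eq, ite_eq_right_iff, one_ne_zero, imp_false,
      not_not] at hm hn
    exact_mod_cast (by linarith : (m : ℝ) = n)
  have hB : Summable fun n : ℤ => 1 / |n + β| ^ (s.re / 2) + 1 / |n + β| ^ s.re :=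
    ((Real.summable_one_div_int_add_rpow β _).mpr (by linarith)).add
      ((Real.summable_one_div_int_add_rpow β _).mpr (by linarith))
  have hAB := (hB.mul_of_nonneg hA (fun n => by positivity)
    (fun m => by dsimp only; positivity)).mul_left (Real.exp (π * |s.im|) * K ^ s.re)
  refine hAB.of_nonneg_of_le (fun p => by positivity) ?_
  rintro ⟨n, m⟩
  dsimp only
  by_cases hb : β + (n : ℝ) = 0
  · rw [if_neg (not_not.mpr hb)]
    positivity
  rw [if_pos hb]
  obtain ⟨ha', hb'⟩ := hbound (α + m) (β + n)
  rw [add_comm (m : ℝ), add_comm (n : ℝ)]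
  set a : ℝ := α + m
  set b : ℝ := β + n
  set N := ‖(a : ℂ) + b * z‖ with hN
  have hbpos : 0 < |b| := abs_pos.mpr hb
  have hNpos : 0 < N := by
    by_contra! h
    nlinarith
  have hu : (a : ℂ) + b * z ≠ 0 := norm_pos_iff.mp hNpos
  refine (norm_cpow_neg_le _ s hu).trans ?_
  rw [mul_assoc]
  refine mul_le_mul_of_nonneg_left ?_ (by positivity)
  rw [← hN, Real.rpow_neg hNpos.le, inv_le_iff_one_le_mul₀ (by positivity)]
  have hKN : 0 < K * N := by positivity
  rw [mul_right_comm, ← Real.mul_rpow hK.le hNpos.le]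
  by_cases ha : a = 0
  · have h1 : |b| ^ s.re ≤ (K * N) ^ s.re := by gcongr
    have h2 : 1 ≤ (K * N) ^ s.re * (1 / |b| ^ s.re) := by
      rw [mul_one_div, one_le_div (by positivity)]; exact h1
    refine h2.trans (mul_le_mul_of_nonneg_left ?_ (by positivity))
    rw [if_pos ha]
    have p1 : 0 ≤ 1 / |b| ^ (s.re / 2) := by positivity
    have p2 : 0 ≤ 1 / |b| ^ s.re := by positivity
    have p3 : 0 ≤ 1 / |a| ^ (s.re / 2) := by positivity
    nlinarith [mul_nonneg p1 p3, mul_nonneg p2 p3]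
  · have hapos : 0 < |a| := abs_pos.mpr ha
    have h1 : |a| ^ (s.re / 2) * |b| ^ (s.re / 2) ≤ (K * N) ^ s.re := by
      calc |a| ^ (s.re / 2) * |b| ^ (s.re / 2)
          ≤ (K * N) ^ (s.re / 2) * (K * N) ^ (s.re / 2) := by gcongr
        _ = (K * N) ^ s.re := by rw [← Real.rpow_add hKN]; ring_nf
    have h2 : 1 ≤ (K * N) ^ s.re * (1 / |b| ^ (s.re / 2) * (1 / |a| ^ (s.re / 2))) := by
      rw [one_div_mul_one_div, mul_one_div, one_le_div (by positivity), mul_comm (|b| ^ _)]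
      exact h1
    refine h2.trans (mul_le_mul_of_nonneg_left ?_ (by positivity))
    rw [if_neg ha, add_zero, add_mul]
    exact le_add_of_nonneg_right (by positivity)

/-- The continuous function whose Poisson summation gives the Lipschitz formula. -/
def lipschitzKernel (s v : ℂ) (y : ℝ) : ℂ :=
  ((max y 0 : ℝ) : ℂ) ^ (s - 1) * Complex.exp (2 * π * Complex.I * v * y)

lemma lipschitzKernel_of_nonpos {s : ℂ} (hs : 1 < s.re) (v : ℂ) {y : ℝ} (hy : y ≤ 0) :
    lipschitzKernel s v y = 0 := by
  have h : s - 1 ≠ 0 := fun h => by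
    have := congrArg Complex.re h
    simp at this
    linarith
  rw [lipschitzKernel, max_eq_right hy, Complex.ofReal_zero, Complex.zero_cpow h, zero_mul]

lemma lipschitzKernel_of_pos (s v : ℂ) {y : ℝ} (hy : 0 < y) :
    lipschitzKernel s v y = (y : ℂ) ^ (s - 1) * Complex.exp (2 * π * Complex.I * v * y) := by
  rw [lipschitzKernel, max_eq_left hy.le]

lemma continuous_lipschitzKernel {s : ℂ} (hs : 1 < s.re) (v : ℂ) :
    Continuous (lipschitzKernel s v) := by
  refine Continuous.mul ?_ (by fun_prop)
  exact (Complex.continuous_ofReal_cpow_const (y := s - 1) (by simpa using hs)).comp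
    (continuous_id.max continuous_const)

lemma lipschitzKernel_isBigO {s : ℂ} (hs : 1 < s.re) {v : ℂ} (hv : 0 < v.im) :
    lipschitzKernel s v =O[Filter.cocompact ℝ] fun x : ℝ => |x| ^ (-2 : ℝ) := by
  rw [cocompact_eq_atBot_atTop, Asymptotics.isBigO_sup]
  constructor
  · refine (Asymptotics.isBigO_zero _ _).congr' ?_ Filter.EventuallyEq.rfl
    filter_upwards [Filter.eventually_le_atBot 0] with y hy
    exact (lipschitzKernel_of_nonpos hs v hy).symm
  · have h := (isLittleO_exp_neg_mul_rpow_atTop (a := 2 * π * v.im) (by positivity)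
      (-2 - (s.re - 1))).isBigO
    have h2 := (Asymptotics.isBigO_refl (fun y : ℝ => y ^ (s.re - 1)) Filter.atTop).mul h
    refine (Asymptotics.IsBigO.congr' (h2.norm_left) ?_ ?_).of_norm_left
    · filter_upwards [Filter.eventually_gt_atTop 0] with y hy
      rw [lipschitzKernel_of_pos s v hy, norm_mul, norm_mul,
        Complex.norm_cpow_eq_rpow_re_of_pos hy, Complex.norm_exp,
        Real.norm_of_nonneg (by positivity), Real.norm_of_nonneg (by positivity)]
      simp
    · filter_upwards [Filter.eventually_gt_atTop 0] with y hy
      rw [← Real.rpow_add hy, abs_of_pos hy]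
      ring_nf

/-- Rotation of the base of a power from the right to the upper half plane. -/
lemma neg_two_pi_I_mul_cpow {u : ℂ} (hu : 0 < u.im) (s : ℂ) :
    (-(2 * π * Complex.I * u)) ^ (-s) =
      ((2 * π : ℝ) : ℂ) ^ (-s) * Complex.exp (π * Complex.I * s / 2) * u ^ (-s) := by
  have hu0 : u ≠ 0 := fun h => by simp [h] at hu
  have h2π : ((2 * π : ℝ) : ℂ) ≠ 0 := by exact_mod_cast Real.two_pi_pos.ne'
  have harg : 0 ≤ u.arg := Complex.arg_nonneg_iff.mpr hu.le
  have harg' := Complex.arg_le_pi u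
  have hπ := Real.pi_pos
  have hexp : -(2 * π * Complex.I * u) =
      Complex.exp ((Real.log (2 * π) : ℝ) + Complex.log u - π / 2 * Complex.I) := by
    rw [Complex.exp_sub, Complex.exp_add, Complex.exp_log hu0, Complex.exp_pi_div_two_mul_I,
      ← Complex.ofReal_exp, Real.exp_log Real.two_pi_pos, Complex.div_I]
    push_cast
    ring
  have him : ((Real.log (2 * π) : ℝ) + Complex.log u - π / 2 * Complex.I).im = u.arg - π / 2 := by
    have : (π / 2 : ℂ) = ((π / 2 : ℝ) : ℂ) := by push_cast; rfl
    rw [this]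
    simp [Complex.log_im]
  have hlog : Complex.log (-(2 * π * Complex.I * u)) =
      (Real.log (2 * π) : ℝ) + Complex.log u - π / 2 * Complex.I := by
    rw [hexp, Complex.log_exp] <;> rw [him] <;> linarith
  have hne : -(2 * π * Complex.I * u) ≠ 0 := by rw [hexp]; exact Complex.exp_ne_zero _
  rw [Complex.cpow_def_of_ne_zero hne, hlog, Complex.cpow_def_of_ne_zero h2π,
    Complex.cpow_def_of_ne_zero hu0, ← Complex.exp_add, ← Complex.exp_add,
    Complex.ofReal_log Real.two_pi_pos.le]
  congr 1
  ring

lemma fourier_lipschitzKernel {s : ℂ} (hs : 1 < s.re) {v : ℂ} (hv : 0 < v.im) (x : ℝ) :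
    FourierTransform.fourier (lipschitzKernel s v) x = ((2 * π : ℝ) : ℂ) ^ (-s) *
      Complex.exp (π * Complex.I * s / 2) * (v - x) ^ (-s) * Complex.Gamma s := by
  have hu : 0 < (v - x).im := by simpa using hv
  have hr : 0 < (-(2 * π * Complex.I * (v - x))).re := by
    have : (-(2 * π * Complex.I * (v - x))).re = 2 * π * (v - x).im := by simp
    rw [this]
    positivity
  rw [← neg_two_pi_I_mul_cpow hu, ← integral_cpow_mul_exp_neg_complex_mul (by linarith) hr,
    Real.fourier_real_eq_integral_exp_smul, ← integral_indicator measurableSet_Ioi]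
  congr 1
  ext y
  by_cases hy : 0 < y
  · rw [Set.indicator_of_mem (show y ∈ Set.Ioi 0 from hy), lipschitzKernel_of_pos s v hy,
      smul_eq_mul, mul_left_comm, ← Complex.exp_add]
    congr 2
    push_cast
    ring
  · rw [Set.indicator_of_notMem (show y ∉ Set.Ioi 0 from hy),
      lipschitzKernel_of_nonpos hs v (not_lt.mp hy), smul_zero]

/-- The rows of the Eisenstein series converge absolutely. -/
lemma summable_row (α : ℝ) (w : ℂ) (hw : 0 < w.im) (s : ℂ) (hs : 2 < s.re) :
    Summable fun m : ℤ => (((α + (m : ℝ) : ℝ) : ℂ) + w) ^ (-s) := by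
  have h := (summable_norm_eisenstein α 1 w hw s hs).prod_factor 0
  simp only [Int.cast_zero, add_zero, ne_eq, one_ne_zero, not_false_eq_true, if_true,
    Complex.ofReal_one, one_mul] at h
  exact h.of_norm

/-- The Lipschitz summation formula with characters. -/
lemma lipschitz_summation (α μ : ℝ) (w : ℂ) (hw : 0 < w.im) (s : ℂ) (hs : 2 < s.re) :
    ∑' m : ℤ, ee (((α + (m : ℝ)) * μ : ℝ) : ℂ) * (((α + (m : ℝ) : ℝ) : ℂ) + w) ^ (-s) =
      ee ((α * μ : ℝ) : ℂ) * (((2 * π : ℝ) : ℂ) ^ s / Complex.Gamma s) *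
        Complex.exp (-(π : ℂ) * Complex.I * s / 2) *
        ∑' l : {l : ℤ // 0 < -μ + (l : ℝ)}, ee (((-μ + (l.1 : ℝ)) * α : ℝ) : ℂ) *
          ((-μ + (l.1 : ℝ) : ℝ) : ℂ) ^ (-(1 - s)) *
          Complex.exp (2 * π * Complex.I * w * ((-μ + (l.1 : ℝ) : ℝ) : ℂ)) := by
  have hs1 : 1 < s.re := by linarith
  have hv : 0 < (w + α).im := by simpa using hw
  have hG : Complex.Gamma s ≠ 0 := Complex.Gamma_ne_zero_of_re_pos (by linarith)
  have h2π : ((2 * π : ℝ) : ℂ) ≠ 0 := by exact_mod_cast Real.two_pi_pos.ne'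
  have hF : ∀ m : ℤ, FourierTransform.fourier (lipschitzKernel s (w + α)) (((-m : ℤ) : ℝ)) =
      ((2 * π : ℝ) : ℂ) ^ (-s) * Complex.exp (π * Complex.I * s / 2) * Complex.Gamma s *
        (((α + (m : ℝ) : ℝ) : ℂ) + w) ^ (-s) := fun m => by
    rw [fourier_lipschitzKernel hs1 hv, mul_right_comm]
    congr 2
    push_cast
    ring
  have hsum : Summable fun n : ℤ => FourierTransform.fourier (lipschitzKernel s (w + α)) (n : ℝ) := by
    rw [← (Equiv.neg ℤ).summable_iff]
    exact ((summable_row α w hw s hs).mul_left _).congr fun m => (hF m).symm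
  have hP := Real.tsum_eq_tsum_fourier_of_rpow_decay_of_summable
    (continuous_lipschitzKernel hs1 (w + α)) one_lt_two (lipschitzKernel_isBigO hs1 hv) hsum (-μ)
  rw [← (Equiv.neg ℤ).tsum_eq (fun n : ℤ =>
    FourierTransform.fourier (lipschitzKernel s (w + α)) (n : ℝ) *
      fourier n ((-μ : ℝ) : UnitAddCircle))] at hP
  have hleft : ∑' l : {l : ℤ // 0 < -μ + (l : ℝ)}, ee (((-μ + (l.1 : ℝ)) * α : ℝ) : ℂ) *
          ((-μ + (l.1 : ℝ) : ℝ) : ℂ) ^ (-(1 - s)) *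
          Complex.exp (2 * π * Complex.I * w * ((-μ + (l.1 : ℝ) : ℝ) : ℂ)) =
      ∑' n : ℤ, lipschitzKernel s (w + α) (-μ + n) := by
    rw [← tsum_subtype_eq_of_support_subset (s := {l : ℤ | 0 < -μ + (l : ℝ)})]
    · refine tsum_congr fun l => ?_
      rw [lipschitzKernel_of_pos s _ l.2, ee, neg_sub, mul_right_comm, ← Complex.exp_add, mul_comm]
      congr 2
      push_cast
      ring
    · intro n hn
      by_contra h
      exact hn (lipschitzKernel_of_nonpos hs1 _ (not_lt.mp h))
  rw [hleft, hP, ← tsum_mul_left]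
  refine tsum_congr fun m => ?_
  rw [Equiv.neg_apply, hF, fourier_coe_apply, Complex.cpow_neg (((2 * π : ℝ) : ℂ))]
  have hpow : ((2 * π : ℝ) : ℂ) ^ s ≠ 0 := by
    rw [Complex.cpow_def_of_ne_zero h2π]; exact Complex.exp_ne_zero _
  have he : Complex.exp (-(π : ℂ) * Complex.I * s / 2) * Complex.exp (π * Complex.I * s / 2) = 1 := by
    rw [← Complex.exp_add, ← Complex.exp_zero]
    congr 1
    ring
  have hc : ee (((α + (m : ℝ)) * μ : ℝ) : ℂ) = ee ((α * μ : ℝ) : ℂ) *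
      Complex.exp (2 * π * Complex.I * ((-m : ℤ) : ℂ) * ((-μ : ℝ) : ℂ) / ((1 : ℝ) : ℂ)) := by
    rw [ee, ee, ← Complex.exp_add]
    congr 1
    push_cast
    ring
  rw [hc]
  generalize Complex.exp (-(π : ℂ) * Complex.I * s / 2) = A at he ⊢
  generalize Complex.exp (π * Complex.I * s / 2) = B at he ⊢
  generalize Complex.exp (2 * π * Complex.I * ((-m : ℤ) : ℂ) * ((-μ : ℝ) : ℂ) / ((1 : ℝ) : ℂ)) = E
  generalize ((((α + (m : ℝ) : ℝ) : ℂ) + w) ^ (-s)) = U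
  generalize (((2 * π : ℝ) : ℂ) ^ s) = Q at *
  field_simp
  linear_combination (-ee ((α * μ : ℝ) : ℂ) * E * U) * he

lemma norm_ee_ofReal (x : ℝ) : ‖ee (x : ℂ)‖ = 1 := by
  rw [ee, Complex.norm_exp]
  simp

/-- The branch change between the lower and the upper half plane. -/
lemma neg_cpow_of_im_pos {u : ℂ} (hu : 0 < u.im) (s : ℂ) :
    (-u) ^ (-s) = Complex.exp (π * Complex.I * s) * u ^ (-s) := by
  have hu0 : u ≠ 0 := fun h => by simp [h] at hu
  rw [Complex.cpow_def_of_ne_zero (neg_ne_zero.mpr hu0), Complex.cpow_def_of_ne_zero hu0,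
    Complex.log, Complex.log, norm_neg, Complex.arg_neg_eq_arg_sub_pi_of_im_pos hu,
    ← Complex.exp_add]
  congr 1
  push_cast
  ring

/-- The Lipschitz summation formula for a shift in the lower half plane. -/
lemma lipschitz_summation_neg (α μ : ℝ) (w : ℂ) (hw : 0 < w.im) (s : ℂ) (hs : 2 < s.re) :
    ∑' m : ℤ, ee (((α + (m : ℝ)) * μ : ℝ) : ℂ) * (((α + (m : ℝ) : ℝ) : ℂ) - w) ^ (-s) =
      ee ((α * μ : ℝ) : ℂ) * (((2 * π : ℝ) : ℂ) ^ s / Complex.Gamma s) *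
        Complex.exp ((π : ℂ) * Complex.I * s / 2) *
        ∑' l : {l : ℤ // 0 < μ + (l : ℝ)}, ee (((μ + (l.1 : ℝ)) * (-α) : ℝ) : ℂ) *
          ((μ + (l.1 : ℝ) : ℝ) : ℂ) ^ (-(1 - s)) *
          Complex.exp (2 * π * Complex.I * w * ((μ + (l.1 : ℝ) : ℝ) : ℂ)) := by
  obtain ⟨κ, rfl⟩ : ∃ κ, μ = -κ := ⟨-μ, (neg_neg μ).symm⟩
  have h := lipschitz_summation (-α) κ w hw s hs
  have he : Complex.exp ((π : ℂ) * Complex.I * s / 2) =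
      Complex.exp (π * Complex.I * s) * Complex.exp (-(π : ℂ) * Complex.I * s / 2) := by
    rw [← Complex.exp_add]
    congr 1
    ring
  rw [he, show α * -κ = -α * κ by ring, mul_left_comm _ (Complex.exp (π * Complex.I * s)), mul_assoc (Complex.exp _), ← h,
    ← tsum_mul_left, ← (Equiv.neg ℤ).tsum_eq]
  refine tsum_congr fun m => ?_
  have hu : 0 < (((-α + (m : ℝ) : ℝ) : ℂ) + w).im := by simpa using hw
  rw [Equiv.neg_apply, mul_left_comm, ← neg_cpow_of_im_pos hu]
  congr 2
  · push_cast
    ring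
  · push_cast
    ring

/-- The terms with `β + n < 0`, reindexed by `n ↦ -n`. -/
lemma tsum_neg_index (γ : ℝ) (f : ℤ → ℂ) :
    ∑' n : {n : ℤ // γ + (n : ℝ) < 0}, f n.1 =
      ∑' n : {n : ℤ // 0 < -γ + (n : ℝ)}, f (-n.1) := by
  refine (Equiv.tsum_eq ((Equiv.neg ℤ).subtypeEquiv fun n => ?_)
    (fun n : {n : ℤ // γ + (n : ℝ) < 0} => f n.1)).symm
  rw [Equiv.neg_apply, Int.cast_neg]
  constructor <;> intro h <;> linarith

lemma axis_term_eq_Acal (s : ℂ) (α μ : ℝ) :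
    ((∑' m : {m : ℤ // 0 < α + (m : ℝ)},
        ee ((((α + (m.1 : ℝ)) * μ : ℝ)) : ℂ) * (((α + (m.1 : ℝ)) : ℝ) : ℂ) ^ (-s)) +
      Complex.cos ((Real.pi : ℂ) * s) *
        ∑' m : {m : ℤ // α + (m : ℝ) < 0},
          ee ((((α + (m.1 : ℝ)) * μ : ℝ)) : ℂ) * ((|α + (m.1 : ℝ)| : ℝ) : ℂ) ^ (-s)) =
      Acal s α μ := by
  rw [tsum_neg_index α (fun m => ee ((((α + (m : ℝ)) * μ : ℝ)) : ℂ) *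
    ((|α + (m : ℝ)| : ℝ) : ℂ) ^ (-s)), Acal, add_comm, psiL, psiL]
  congr 2
  refine tsum_congr fun m => ?_
  have h : α + ((-m.1 : ℤ) : ℝ) = -(-α + (m.1 : ℝ)) := by push_cast; ring
  rw [h, abs_neg, abs_of_pos m.2, neg_mul, mul_neg]

/-- A double series over `γ + n ≠ 0` splits by the sign of `γ + n`. -/
lemma tsum_prod_ne_zero_split (γ : ℝ) (g : ℤ → ℤ → ℂ)
    (hg : Summable fun p : ℤ × ℤ => if γ + (p.1 : ℝ) ≠ 0 then ‖g p.1 p.2‖ else 0) :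
    ∑' p : {p : ℤ × ℤ // γ + (p.2 : ℝ) ≠ 0}, g p.1.2 p.1.1 =
      (∑' n : {n : ℤ // 0 < γ + (n : ℝ)}, ∑' m, g n.1 m) +
        ∑' n : {n : ℤ // γ + (n : ℝ) < 0}, ∑' m, g n.1 m := by
  have hG : Summable fun p : ℤ × ℤ => if γ + (p.1 : ℝ) ≠ 0 then g p.1 p.2 else 0 := by
    refine Summable.of_norm (hg.congr fun p => ?_)
    split_ifs <;> simp
  have hrow : Summable fun n : ℤ => ∑' m, if γ + (n : ℝ) ≠ 0 then g n m else 0 := hG.prod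
  have h1 : ∑' p : {p : ℤ × ℤ // γ + (p.2 : ℝ) ≠ 0}, g p.1.2 p.1.1 =
      ∑' n : ℤ, ∑' m, if γ + (n : ℝ) ≠ 0 then g n m else 0 := by
    rw [← hG.tsum_prod, ← (Equiv.prodComm ℤ ℤ).tsum_eq]
    refine (tsum_subtype {p : ℤ × ℤ | γ + (p.2 : ℝ) ≠ 0} fun p => g p.2 p.1).trans ?_
    refine tsum_congr fun p => ?_
    by_cases h : γ + (p.2 : ℝ) = 0 <;> simp [h]
  have hpos : ∑' n : {n : ℤ // 0 < γ + (n : ℝ)}, ∑' m, g n.1 m =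
      ∑' n : ({n : ℤ | 0 < γ + (n : ℝ)} : Set ℤ),
        ∑' m, if γ + ((n : ℤ) : ℝ) ≠ 0 then g n m else 0 :=
    tsum_congr fun n => tsum_congr fun m => by rw [if_pos n.2.ne']
  have hneg : ∑' n : {n : ℤ // γ + (n : ℝ) < 0}, ∑' m, g n.1 m =
      ∑' n : ({n : ℤ | γ + (n : ℝ) < 0} : Set ℤ),
        ∑' m, if γ + ((n : ℤ) : ℝ) ≠ 0 then g n m else 0 :=
    tsum_congr fun n => tsum_congr fun m => by rw [if_pos n.2.ne]
  rw [h1, hpos, hneg]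
  rw [← Summable.tsum_union_disjoint (s := {n : ℤ | 0 < γ + (n : ℝ)})
    (t := {n : ℤ | γ + (n : ℝ) < 0}) (f := fun n : ℤ => ∑' m, if γ + (n : ℝ) ≠ 0 then g n m else 0)
    (Set.disjoint_left.mpr fun n (h : 0 < γ + (n : ℝ)) (h' : γ + (n : ℝ) < 0) => lt_asymm h h')
    (hrow.subtype _) (hrow.subtype _)]
  refine (tsum_subtype_eq_of_support_subset fun n hn => ?_).symm
  by_contra h
  simp only [Set.mem_union, Set.mem_ofPred_eq, not_or, not_lt] at h
  exact hn (by simp [le_antisymm h.1 h.2])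

/-- Theorem 1 of the paper: transformation formula for `F_{ℤ²}` for `Re s > 2`,
with `τ = -iz` and `q = e(z) = e^{-2πτ}`. -/
theorem statement0 (α β μ ν : ℝ) (z : ℂ) (hz : 0 < z.im) (s : ℂ) (hs : 2 < s.re) :
    Fz2 s α β μ ν z =
      dInt β * Acal s α μ +
        ee ((α * μ : ℝ) : ℂ) * (((2 * Real.pi : ℝ) : ℂ) ^ s / Complex.Gamma s) *
          (Complex.exp (-(Real.pi : ℂ) * Complex.I * s / 2) *
              Scal (1 - s) β (-μ) ν α (-Complex.I * z) +
            Complex.exp ((Real.pi : ℂ) * Complex.I * s / 2) *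
              Scal (1 - s) (-β) μ (-ν) (-α) (-Complex.I * z)) := by
  have hsplit := tsum_prod_ne_zero_split β (fun n m =>
    ee ((((α + (m : ℝ)) * μ + (β + (n : ℝ)) * ν : ℝ)) : ℂ) *
      ((((α + (m : ℝ)) : ℝ) : ℂ) + (((β + (n : ℝ)) : ℝ) : ℂ) * z) ^ (-s))
    ((summable_norm_eisenstein α β z hz s hs).congr fun p => by rw [norm_mul, norm_ee_ofReal, one_mul])
  have ee_add : ∀ x y : ℝ, ee ((x + y : ℝ) : ℂ) = ee (y : ℂ) * ee (x : ℂ) := fun x y => by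
    rw [ee, ee, ee, ← Complex.exp_add]
    congr 1
    push_cast
    ring
  rw [tsum_neg_index β (fun n => ∑' m : ℤ, ee ((((α + (m : ℝ)) * μ + (β + (n : ℝ)) * ν : ℝ)) : ℂ) *
      ((((α + (m : ℝ)) : ℝ) : ℂ) + (((β + (n : ℝ)) : ℝ) : ℂ) * z) ^ (-s))] at hsplit
  rw [Fz2, axis_term_eq_Acal, hsplit, add_comm, mul_add, ← mul_assoc, ← mul_assoc, Scal, Scal,
    ← tsum_mul_left, ← tsum_mul_left]
  congr 2
  · refine tsum_congr fun n => ?_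
    have hw : 0 < (((β + (n.1 : ℝ) : ℝ) : ℂ) * z).im := by
      rw [Complex.im_ofReal_mul]
      exact mul_pos n.2 hz
    simp_rw [ee_add, mul_assoc (ee ((_ * ν : ℝ) : ℂ))]
    rw [tsum_mul_left, lipschitz_summation α μ _ hw s hs, mul_left_comm, ← tsum_mul_left]
    congr 1
    refine tsum_congr fun l => ?_
    have hexp : 2 * π * Complex.I * (((β + (n.1 : ℝ) : ℝ) : ℂ) * z) * ((-μ + (l.1 : ℝ) : ℝ) : ℂ) =
        -2 * π * (-Complex.I * z) * ((β + (n.1 : ℝ) : ℝ) : ℂ) * ((-μ + (l.1 : ℝ) : ℝ) : ℂ) := by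
      ring
    rw [hexp]
    ring
  · refine tsum_congr fun n => ?_
    have hw : 0 < (((-β + (n.1 : ℝ) : ℝ) : ℂ) * z).im := by
      rw [Complex.im_ofReal_mul]
      exact mul_pos n.2 hz
    have hb : β + ((-n.1 : ℤ) : ℝ) = -(-β + (n.1 : ℝ)) := by push_cast; ring
    have hfac : ∀ m : ℤ, ee ((((α + (m : ℝ)) * μ + (β + ((-n.1 : ℤ) : ℝ)) * ν : ℝ)) : ℂ) *
        ((((α + (m : ℝ)) : ℝ) : ℂ) + (((β + ((-n.1 : ℤ) : ℝ)) : ℝ) : ℂ) * z) ^ (-s) =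
        ee (((-β + (n.1 : ℝ)) * -ν : ℝ) : ℂ) * (ee ((((α + (m : ℝ)) * μ : ℝ)) : ℂ) *
          ((((α + (m : ℝ)) : ℝ) : ℂ) - (((-β + (n.1 : ℝ)) : ℝ) : ℂ) * z) ^ (-s)) := fun m => by
      rw [hb, ee_add, mul_assoc, Complex.ofReal_neg, neg_mul, neg_mul, mul_neg, sub_eq_add_neg]
    rw [tsum_congr hfac, tsum_mul_left, lipschitz_summation_neg α μ _ hw s hs, mul_left_comm,
      ← tsum_mul_left]
    congr 1
    refine tsum_congr fun l => ?_
    have hexp : 2 * π * Complex.I * (((-β + (n.1 : ℝ) : ℝ) : ℂ) * z) * ((μ + (l.1 : ℝ) : ℝ) : ℂ) =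
        -2 * π * (-Complex.I * z) * ((-β + (n.1 : ℝ) : ℝ) : ℂ) * ((μ + (l.1 : ℝ) : ℝ) : ℂ) := by
      ring
    rw [ee_add, hexp]
    ring

end
end

section
/- Let α, β, μ, ν be real, let s ∈ ℂ with Re s > 2, let J ≥ 0 be an integer, and let 0 < η < π/2. Define 𝓑₁(s,α,μ) := i·sin(πs)·ψ(s,−α,−μ), 𝓑₂(s,β,ν) := e^{πis/2}ψ(s,−β,−ν) + e^{−πis/2}ψ(s,β,ν), and S_J(s;α,β;μ,ν;iτ) := 2 sin(πs)·Σ_{j=−1}^{J−1} (i^{j+1}(s)_j/(j+1)!)·ψ(s+j,−α,−μ)·𝒞_{j+1}(⟨β⟩,ν)·τ^j, where (s)_j := Γ(s+j)/Γ(s) (so (s)_{−1} = 1/(s−1)). Then there exist constants C > 0 and δ₀ > 0 such that for all τ ∈ ℂ with 0 < |τ| ≤ δ₀ and |arg τ| ≤ π/2 − η, | F_{ℤ²}(s;α,β;μ,ν;iτ) − δ(β)𝓑₁(s,α,μ) − δ(α)𝓑₂(s,β,ν)·τ^{−s} − S_J(s;α,β;μ,ν;iτ) | ≤ C·|τ|^J,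 where τ^{−s} := exp(−s·Log τ) with the principal logarithm. -/
noncomputable section

open Complex MeasureTheory
open scoped Real Classical

/-- A power series which sums to zero on a punctured neighbourhood of the origin vanishes. -/
lemma coeff_eq_zero_of_hasSum_zero {d : ℕ → ℂ}
    (h : ∀ᶠ Z in nhdsWithin (0 : ℂ) {(0 : ℂ)}ᶜ, HasSum (fun k : ℕ => d k * Z ^ k) 0) (k : ℕ) :
    d k = 0 := by
  set p := FormalMultilinearSeries.ofScalars ℂ d with hp
  let f : ℂ → ℂ := fun Z => if Z = 0 then d 0 else 0
  have hf : HasFPowerSeriesAt f p 0 := by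
    rw [hasFPowerSeriesAt_iff]
    rw [eventually_nhdsWithin_iff] at h
    filter_upwards [h] with Z hZ
    by_cases h0 : Z = 0
    · subst h0
      have := hasSum_single (f := fun n : ℕ => (0 : ℂ) ^ n • p.coeff n) 0 (by
        intro n hn; simp [hn])
      simpa [f, hp, FormalMultilinearSeries.coeff_ofScalars] using this
    · have := hZ h0
      simpa [f, h0, hp, FormalMultilinearSeries.coeff_ofScalars, mul_comm] using this
  have h0 : ∀ᶠ Z in nhds (0 : ℂ), f Z = 0 := by
    rw [← hf.analyticAt.frequently_zero_iff_eventually_zero]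
    apply Filter.Eventually.frequently
    filter_upwards [self_mem_nhdsWithin] with Z hZ
    have : Z ≠ 0 := hZ
    simp [f, this]
  have hp0 : p = 0 := HasFPowerSeriesAt.eq_zero (hf.congr h0)
  have : p.coeff k = d k := by rw [hp, FormalMultilinearSeries.coeff_ofScalars]
  rw [← this, hp0]
  rfl

/-- The recursion satisfied by the Taylor coefficients of
`Z e(Xκ) e^{XZ} / (e(κ) e^Z - 1)`. -/
lemma taylorCoeff_recursion {c : ℕ → ℂ} {X : ℂ} {κ : ℝ}
    (hc : ∀ᶠ Z in nhdsWithin (0 : ℂ) {(0 : ℂ)}ᶜ,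
      HasSum (fun j : ℕ => c j * Z ^ j / (Nat.factorial j : ℂ))
        (Z * ee (X * (κ : ℂ)) * Complex.exp (X * Z) / (ee ((κ : ℝ) : ℂ) * Complex.exp Z - 1)))
    (k : ℕ) :
    ee κ * ∑ i ∈ Finset.range (k + 1), c i / (i.factorial : ℂ) * (1 / ((k - i).factorial : ℂ)) -
      c k / (k.factorial : ℂ) =
    if k = 0 then 0 else ee (X * κ) * (X ^ (k - 1) / ((k - 1).factorial : ℂ)) := by
  have hexp : ∀ Y : ℂ, HasSum (fun n : ℕ => Y ^ n / (n.factorial : ℂ)) (Complex.exp Y) := by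
    intro Y
    rw [Complex.exp_eq_exp_ℂ]
    exact NormedSpace.expSeries_div_hasSum_exp Y
  rw [← sub_eq_zero]
  refine coeff_eq_zero_of_hasSum_zero (d := fun k =>
    ee κ * ∑ i ∈ Finset.range (k + 1), c i / (i.factorial : ℂ) * (1 / ((k - i).factorial : ℂ)) -
      c k / (k.factorial : ℂ) -
    if k = 0 then 0 else ee (X * κ) * (X ^ (k - 1) / ((k - 1).factorial : ℂ))) ?_ k
  have hne : ∀ᶠ Z in nhdsWithin (0 : ℂ) {(0 : ℂ)}ᶜ, ee κ * Complex.exp Z ≠ 1 := by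
    have hd : HasDerivAt (fun Z => ee κ * Complex.exp Z) (ee κ * Complex.exp 0) 0 :=
      (Complex.hasDerivAt_exp 0).const_mul _
    exact hd.eventually_ne (mul_ne_zero (Complex.exp_ne_zero _) (Complex.exp_ne_zero _))
  filter_upwards [hc, hne] with Z hZ hZne
  have hprod := hasSum_sum_range_mul_of_summable_norm hZ.summable.norm (hexp Z).summable.norm
  rw [hZ.tsum_eq, (hexp Z).tsum_eq] at hprod
  have hrhs : HasSum (fun k : ℕ => (if k = 0 then 0 else
      ee (X * κ) * (X ^ (k - 1) / ((k - 1).factorial : ℂ))) * Z ^ k)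
      (Z * ee (X * κ) * Complex.exp (X * Z)) := by
    rw [← hasSum_nat_add_iff' 1]
    have := (hexp (X * Z)).mul_left (Z * ee (X * κ))
    convert! this using 1
    · ext n
      simp only [Nat.add_eq_zero_iff, one_ne_zero, and_false, if_false, Nat.add_sub_cancel]
      ring
    · simp
  have hne' : ee κ * Complex.exp Z - 1 ≠ 0 := sub_ne_zero.mpr hZne
  convert! ((hprod.mul_left (ee κ)).sub hZ).sub hrhs using 1
  · ext n
    rw [sub_mul, sub_mul, mul_assoc, Finset.sum_mul]
    congr 2
    · congr 1
      refine Finset.sum_congr rfl fun i hi => ?_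
      have hi' : i ≤ n := by simpa [Nat.lt_succ_iff] using hi
      have : Z ^ n = Z ^ i * Z ^ (n - i) := by rw [← pow_add]; congr 1; omega
      rw [this]; ring
    · ring
  · field_simp
    ring

/-- Taylor's formula for a chain of successive derivatives. -/
lemma taylor_chain_bound {G : ℕ → ℝ → ℂ} (hG : ∀ k t, HasDerivAt (G k) (G (k + 1) t) t)
    {a M : ℝ} (K : ℕ) (j : ℕ) (hM : ∀ t ∈ Set.Icc a (a + 1), ‖G (j + K) t‖ ≤ M) :
    ∀ h ∈ Set.Icc (0 : ℝ) 1,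
      ‖G j (a + h) - ∑ l ∈ Finset.range K, G (j + l) a * ((h : ℂ) ^ l / (l.factorial : ℂ))‖ ≤ M := by
  induction K generalizing j with
  | zero =>
    intro h hh
    simpa using hM (a + h) ⟨by linarith [hh.1], by linarith [hh.2]⟩
  | succ K ih =>
    intro h hh
    have hM0 : 0 ≤ M := (norm_nonneg _).trans (hM a ⟨le_rfl, by linarith⟩)
    have ih' := ih (j + 1) (fun t ht => by
      have := hM t ht
      rwa [show j + 1 + K = j + (K + 1) by ring])
    let Φ : ℝ → ℂ := fun h =>
      G j (a + h) - ∑ l ∈ Finset.range (K + 1), G (j + l) a * ((h : ℂ) ^ l / (l.factorial : ℂ))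
    have hpow : ∀ (l : ℕ) (t : ℝ), HasDerivAt (fun h : ℝ => (h : ℂ) ^ l / (l.factorial : ℂ))
        (if l = 0 then 0 else (t : ℂ) ^ (l - 1) / ((l - 1).factorial : ℂ)) t := by
      intro l t
      have h1 : HasDerivAt (fun h : ℂ => h ^ l / (l.factorial : ℂ))
          ((l : ℂ) * (t : ℂ) ^ (l - 1) / (l.factorial : ℂ)) (t : ℂ) :=
        (hasDerivAt_pow l (t : ℂ)).div_const _
      convert h1.comp_ofReal using 1
      rcases l with _ | l
      · simp
      · have : ((l : ℂ) + 1) ≠ 0 := by exact_mod_cast Nat.succ_ne_zero l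
        simp only [Nat.add_eq_zero_iff, one_ne_zero, and_false, if_false, Nat.add_sub_cancel,
          Nat.factorial_succ]
        push_cast
        have hf : (l.factorial : ℂ) ≠ 0 := by exact_mod_cast l.factorial_ne_zero
        field_simp
    have hΦ : ∀ t, HasDerivAt Φ (G (j + 1) (a + t) -
        ∑ l ∈ Finset.range K, G (j + 1 + l) a * ((t : ℂ) ^ l / (l.factorial : ℂ))) t := by
      intro t
      have h1 : HasDerivAt (fun h => G j (a + h)) (G (j + 1) (a + t)) t :=
        (hG j (a + t)).comp_const_add a t
      have h2 := HasDerivAt.fun_sum (u := Finset.range (K + 1)) (fun l _ =>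
        (hpow l t).const_mul (G (j + l) a))
      convert! h1.sub h2 using 1
      congr 1
      rw [Finset.sum_range_succ']
      simp only [Nat.add_eq_zero_iff, one_ne_zero, and_false, if_false, Nat.add_sub_cancel, if_true,
        mul_zero, add_zero]
      refine Finset.sum_congr rfl fun l _ => ?_
      rw [show j + 1 + l = j + (l + 1) by ring]
    have := norm_image_sub_le_of_norm_deriv_le_segment' (f := Φ) (a := 0) (b := 1) (C := M)
      (fun t _ => (hΦ t).hasDerivWithinAt) (fun t ht => ih' t ⟨ht.1, ht.2.le⟩) h hh
    have hΦ0 : Φ 0 = 0 := by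
      simp [Φ, Finset.sum_range_succ']
    rw [hΦ0, sub_zero, sub_zero] at this
    refine this.trans ?_
    nlinarith [hh.2]

/-- The local form of the Euler–Maclaurin formula twisted by a character. -/
lemma eulerMaclaurin_step {c : ℕ → ℂ} {x ν : ℝ} (hx : x ∈ Set.Icc (0 : ℝ) 1)
    (hc : ∀ k : ℕ, ee ν * ∑ i ∈ Finset.range (k + 1),
        c i / (i.factorial : ℂ) * (1 / ((k - i).factorial : ℂ)) - c k / (k.factorial : ℂ) =
      if k = 0 then 0 else ee ((x : ℂ) * ν) * ((x : ℂ) ^ (k - 1) / ((k - 1).factorial : ℂ)))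
    {G : ℕ → ℝ → ℂ} (hG : ∀ k t, HasDerivAt (G k) (G (k + 1) t) t)
    {a M : ℝ} (N : ℕ) (hM : ∀ t ∈ Set.Icc a (a + 1), ‖G (N + 1) t‖ ≤ M) :
    ‖ee ((x : ℂ) * ν) * G 1 (a + x) -
      (ee ν * ∑ k ∈ Finset.range (N + 1), c k / (k.factorial : ℂ) * G k (a + 1) -
        ∑ k ∈ Finset.range (N + 1), c k / (k.factorial : ℂ) * G k a)‖ ≤
      (1 + ∑ k ∈ Finset.range (N + 1), ‖c k / (k.factorial : ℂ)‖) * M := by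
  set b : ℕ → ℂ := fun k => c k / (k.factorial : ℂ) with hb
  have hR1 := taylor_chain_bound hG N 1 (by rwa [add_comm 1 N]) x hx
  have hRk : ∀ k ∈ Finset.range (N + 1),
      ‖G k (a + 1) - ∑ l ∈ Finset.range (N + 1 - k), G (k + l) a * (1 / (l.factorial : ℂ))‖ ≤ M := by
    intro k hk
    have hk' : k ≤ N + 1 := (Finset.mem_range.mp hk).le
    have := taylor_chain_bound hG (N + 1 - k) k
      (by rwa [show k + (N + 1 - k) = N + 1 by omega]) 1 ⟨zero_le_one, le_rfl⟩
    simpa using this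
  have hdouble : ∑ k ∈ Finset.range (N + 1), b k *
        ∑ l ∈ Finset.range (N + 1 - k), G (k + l) a * (1 / (l.factorial : ℂ)) =
      ∑ j ∈ Finset.range (N + 1), G j a *
        ∑ k ∈ Finset.range (j + 1), b k * (1 / ((j - k).factorial : ℂ)) := by
    have := Finset.sum_range_diag_flip (N + 1)
      (fun k l => b k * (G (k + l) a * (1 / (l.factorial : ℂ))))
    simp only [Finset.mul_sum]
    rw [← this]
    refine Finset.sum_congr rfl fun j _ => Finset.sum_congr rfl fun k hk => ?_
    have : k ≤ j := by simpa [Nat.lt_succ_iff] using hk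
    rw [show k + (j - k) = j by omega]
    ring
  have hmain : ee ν * ∑ j ∈ Finset.range (N + 1), G j a *
        ∑ k ∈ Finset.range (j + 1), b k * (1 / ((j - k).factorial : ℂ)) -
      ∑ j ∈ Finset.range (N + 1), b j * G j a =
      ee ((x : ℂ) * ν) *
        ∑ l ∈ Finset.range N, G (1 + l) a * ((x : ℂ) ^ l / (l.factorial : ℂ)) := by
    have : ∀ j, ee ν * (G j a * ∑ k ∈ Finset.range (j + 1), b k * (1 / ((j - k).factorial : ℂ))) -
        b j * G j a = G j a * (if j = 0 then 0 else
          ee ((x : ℂ) * ν) * ((x : ℂ) ^ (j - 1) / ((j - 1).factorial : ℂ))) := by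
      intro j
      rw [← hc j]
      ring
    rw [Finset.mul_sum, ← Finset.sum_sub_distrib, Finset.sum_congr rfl fun j _ => this j,
      Finset.sum_range_succ', Finset.mul_sum]
    simp only [Nat.add_eq_zero_iff, one_ne_zero, and_false, if_false, Nat.add_sub_cancel, if_true,
      mul_zero, add_zero]
    refine Finset.sum_congr rfl fun l _ => ?_
    rw [add_comm 1 l]
    ring
  have key : ee ((x : ℂ) * ν) * G 1 (a + x) -
      (ee ν * ∑ k ∈ Finset.range (N + 1), b k * G k (a + 1) -
        ∑ k ∈ Finset.range (N + 1), b k * G k a) =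
      ee ((x : ℂ) * ν) * (G 1 (a + x) -
        ∑ l ∈ Finset.range N, G (1 + l) a * ((x : ℂ) ^ l / (l.factorial : ℂ))) -
      ee ν * ∑ k ∈ Finset.range (N + 1), b k * (G k (a + 1) -
        ∑ l ∈ Finset.range (N + 1 - k), G (k + l) a * (1 / (l.factorial : ℂ))) := by
    simp only [mul_sub, Finset.sum_sub_distrib]
    rw [hdouble]
    linear_combination (-1 : ℂ) * hmain
  rw [key, add_mul, one_mul]
  refine (norm_sub_le _ _).trans (add_le_add ?_ ?_)
  · rw [norm_mul, ← Complex.ofReal_mul, norm_ee_ofReal, one_mul]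
    exact hR1
  · rw [norm_mul, norm_ee_ofReal, one_mul, Finset.sum_mul]
    refine (norm_sum_le _ _).trans (Finset.sum_le_sum fun k hk => ?_)
    rw [norm_mul]
    exact mul_le_mul_of_nonneg_left (hRk k hk) (norm_nonneg _)

/-- Comparison of a series with an approximate telescoping series. -/
lemma norm_tsum_add_le_of_telescope {v U : ℕ → ℂ} {E : ℕ → ℝ} (hv : Summable v) (hE : Summable E)
    (hU : Filter.Tendsto U Filter.atTop (nhds 0))
    (h : ∀ n, ‖v n - (U (n + 1) - U n)‖ ≤ E n) :
    ‖∑' n, v n + U 0‖ ≤ ∑' n, E n := by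
  have hlim : Filter.Tendsto (fun L => ∑ n ∈ Finset.range L, v n - (U L - U 0)) Filter.atTop
      (nhds (∑' n, v n - (0 - U 0))) :=
    hv.hasSum.tendsto_sum_nat.sub (hU.sub_const _)
  have hE0 : ∀ n, 0 ≤ E n := fun n => (norm_nonneg _).trans (h n)
  have := le_of_tendsto hlim.norm (Filter.Eventually.of_forall fun L => ?_) (b := ∑' n, E n)
  · simpa using this
  · rw [← Finset.sum_range_sub, ← Finset.sum_sub_distrib]
    refine (norm_sum_le _ _).trans ((Finset.sum_le_sum fun n _ => h n).trans ?_)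
    exact hE.sum_le_tsum _ (fun n _ => hE0 n)

lemma norm_cpow_neg_le_s2 {w p : ℂ} {y : ℝ} (hy : 0 < y) (hyw : y ≤ ‖w‖) (hp : 0 ≤ p.re) :
    ‖w ^ (-p)‖ ≤ Real.exp (Real.pi * |p.im|) * y ^ (-p.re) := by
  have h1 := Complex.norm_cpow_le w (-p)
  rw [div_eq_mul_inv, ← Real.exp_neg, mul_comm] at h1
  refine h1.trans (mul_le_mul ?_ ?_ (Real.rpow_nonneg (norm_nonneg _) _) (Real.exp_pos _).le)
  · rw [Real.exp_le_exp, Complex.neg_im, mul_neg, neg_neg]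
    refine (le_abs_self _).trans ?_
    rw [abs_mul]
    exact mul_le_mul_of_nonneg_right (Complex.abs_arg_le_pi w) (abs_nonneg _)
  · rw [Complex.neg_re]
    exact Real.rpow_le_rpow_of_nonpos hy hyw (by linarith)

lemma summable_one_add_abs_rpow (γ : ℝ) {p : ℝ} (hp : 1 < p) :
    Summable fun n : ℤ => (1 + |γ + n|) ^ (-p) := by
  have h1 := (Real.summable_one_div_int_add_rpow γ p).mpr hp
  have h2 := (Real.summable_one_div_int_add_rpow (γ + 1) p).mpr hp
  refine Summable.of_nonneg_of_le (fun n => by positivity) (fun n => ?_) (h1.add h2)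
  have key : ∀ y : ℝ, y ≠ 0 → |y| ≤ 1 + |γ + n| → (1 + |γ + n|) ^ (-p) ≤ 1 / |y| ^ p := by
    intro y hy hle
    rw [one_div, ← Real.rpow_neg (abs_nonneg _)]
    exact Real.rpow_le_rpow_of_nonpos (abs_pos.mpr hy) hle (by linarith)
  by_cases h0 : (n : ℝ) + γ = 0
  · have := key (n + (γ + 1)) (by rw [← add_assoc, h0]; norm_num)
      (by rw [← add_assoc, h0]; simp)
    have h3 : 0 ≤ 1 / |(n : ℝ) + γ| ^ p := by positivity
    linarith
  · have := key (n + γ) h0 (by rw [add_comm]; linarith)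
    have h3 : 0 ≤ 1 / |(n : ℝ) + (γ + 1)| ^ p := by positivity
    linarith

/-- The functions `t ↦ (A + tθ)^{-s}` (for `k = 1`), their primitive vanishing at infinity (for
`k = 0`), and their successive derivatives (for `k ≥ 2`). -/
def powChain (s θ : ℂ) (A : ℝ) (k : ℕ) (t : ℝ) : ℂ :=
  (-θ) ^ ((k : ℤ) - 1) * (Complex.Gamma (s + ((k : ℂ) - 1)) / Complex.Gamma s) *
    ((A : ℂ) + t * θ) ^ (-(s + ((k : ℂ) - 1)))

lemma add_mul_mem_slitPlane {θ : ℂ} (hθ : θ.im ≠ 0) {A : ℝ} (hA : 0 < A) (t : ℝ) :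
    (A : ℂ) + t * θ ∈ Complex.slitPlane := by
  rw [Complex.mem_slitPlane_iff]
  by_cases ht : t = 0
  · left; simp [ht, hA]
  · right; simp [ht, hθ]

lemma hasDerivAt_powChain {s θ : ℂ} (hs : 1 < s.re) (hθ : θ.im ≠ 0) {A : ℝ} (hA : 0 < A) (k : ℕ)
    (t : ℝ) : HasDerivAt (powChain s θ A k) (powChain s θ A (k + 1) t) t := by
  have hθ0 : -θ ≠ 0 := by
    intro h
    rw [neg_eq_zero] at h
    simp [h] at hθ
  have hlin : HasDerivAt (fun z : ℂ => (A : ℂ) + z * θ) (θ) (t : ℂ) := by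
    simpa using ((hasDerivAt_id (t : ℂ)).mul_const θ).const_add (A : ℂ)
  have h1 := (hlin.cpow_const (c := -(s + ((k : ℂ) - 1)))
    (add_mul_mem_slitPlane hθ hA t)).comp_ofReal
  have h2 := h1.const_mul ((-θ) ^ ((k : ℤ) - 1) *
    (Complex.Gamma (s + ((k : ℂ) - 1)) / Complex.Gamma s))
  have hk : s + ((k : ℂ) - 1) ≠ 0 := by
    intro h
    have := congrArg Complex.re h
    simp at this
    have hk0 : (0 : ℝ) ≤ k := k.cast_nonneg
    linarith
  convert! h2 using 1
  unfold powChain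
  have hΓ : Complex.Gamma (s + (((k + 1 : ℕ) : ℂ) - 1)) =
      (s + ((k : ℂ) - 1)) * Complex.Gamma (s + ((k : ℂ) - 1)) := by
    rw [← Complex.Gamma_add_one _ hk]
    congr 1; push_cast; ring
  have he : -(s + (((k + 1 : ℕ) : ℂ) - 1)) = -(s + ((k : ℂ) - 1)) - 1 := by push_cast; ring
  have hz : (-θ) ^ (((k + 1 : ℕ) : ℤ) - 1) = (-θ) ^ ((k : ℤ) - 1) * (-θ) := by
    rw [← zpow_add_one₀ hθ0]; congr 1; push_cast; ring
  rw [hΓ, he, hz]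
  ring

lemma norm_powChain_le {s θ : ℂ} (hs : 1 < s.re) {c A : ℝ} (hc : 0 < c) (hA : 0 < A)
    (hcθ : ∀ a t : ℝ, c * (|a| + |t| * ‖θ‖) ≤ ‖(a : ℂ) + t * θ‖) (k : ℕ) (t : ℝ) :
    ‖powChain s θ A k t‖ ≤ ‖θ‖ ^ ((k : ℤ) - 1) *
      ‖Complex.Gamma (s + ((k : ℂ) - 1)) / Complex.Gamma s‖ *
      (Real.exp (Real.pi * |s.im|) * (c * (A + |t| * ‖θ‖)) ^ (-(s.re + ((k : ℝ) - 1)))) := by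
  unfold powChain
  rw [norm_mul, norm_mul, norm_zpow, norm_neg]
  refine mul_le_mul_of_nonneg_left ?_ (by positivity)
  have h := hcθ A t
  rw [abs_of_pos hA] at h
  have := norm_cpow_neg_le_s2 (p := s + ((k : ℂ) - 1)) (by positivity) h (by
    have hk0 : (0 : ℝ) ≤ k := k.cast_nonneg
    simp
    linarith)
  simpa using this

lemma norm_powChain_le_of_le_abs {s θ : ℂ} (hs : 1 < s.re) {c A : ℝ} (hc : 0 < c) (hθ : θ ≠ 0)
    (hθA : ‖θ‖ ≤ A) (hcθ : ∀ a t : ℝ, c * (|a| + |t| * ‖θ‖) ≤ ‖(a : ℂ) + t * θ‖) (J i n : ℕ) {t : ℝ}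
    (ht : (n : ℝ) ≤ |t|) :
    ‖powChain s θ A (J + 1 + i) t‖ ≤
      (‖Complex.Gamma (s + (((J + 1 + i : ℕ) : ℂ) - 1)) / Complex.Gamma s‖ *
        Real.exp (Real.pi * |s.im|) * c ^ (-(s.re + ((J : ℝ) + i)))) *
        (‖θ‖ ^ J * A ^ (-(s.re + J))) * (1 / ((n : ℝ) + 1) ^ i) := by
  have hr : 0 < ‖θ‖ := norm_pos_iff.mpr hθ
  have hA : 0 < A := hr.trans_le hθA
  refine (norm_powChain_le hs hc hA hcθ _ t).trans ?_
  have he : s.re + (((J + 1 + i : ℕ) : ℝ) - 1) = s.re + ((J : ℝ) + i) := by push_cast; ring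
  have hz : ‖θ‖ ^ (((J + 1 + i : ℕ) : ℤ) - 1) = ‖θ‖ ^ J * ‖θ‖ ^ i := by
    rw [← pow_add, ← zpow_natCast]; congr 1; push_cast; ring
  rw [he, hz]
  set y := A + |t| * ‖θ‖ with hy
  have hyA : A ≤ y := by rw [hy]; nlinarith [abs_nonneg t]
  have hyn : ‖θ‖ * (n + 1) ≤ y := by rw [hy]; nlinarith
  have hy0 : 0 < y := hA.trans_le hyA
  have hsplit : y ^ (-(s.re + ((J : ℝ) + i))) = y ^ (-(s.re + J)) * (y ^ i)⁻¹ := by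
    rw [← Real.rpow_natCast y i, ← Real.rpow_neg hy0.le, ← Real.rpow_add hy0]
    congr 1; ring
  have hJ0 : (0 : ℝ) ≤ J := J.cast_nonneg
  have h1 : y ^ (-(s.re + J)) ≤ A ^ (-(s.re + J)) :=
    Real.rpow_le_rpow_of_nonpos hA hyA (by linarith)
  have h2 : ‖θ‖ ^ i * (y ^ i)⁻¹ ≤ 1 / ((n : ℝ) + 1) ^ i := by
    rw [← div_eq_mul_inv, div_le_div_iff₀ (by positivity) (by positivity), ← mul_pow, one_mul]
    exact pow_le_pow_left₀ (by positivity) hyn i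
  rw [Real.mul_rpow hc.le hy0.le, hsplit]
  set g := ‖Complex.Gamma (s + (((J + 1 + i : ℕ) : ℂ) - 1)) / Complex.Gamma s‖
  have h3 : y ^ (-(s.re + J)) * (‖θ‖ ^ i * (y ^ i)⁻¹) ≤
      A ^ (-(s.re + J)) * (1 / ((n : ℝ) + 1) ^ i) := by
    gcongr
  calc _ = (g * Real.exp (Real.pi * |s.im|) * c ^ (-(s.re + ((J : ℝ) + i))) * ‖θ‖ ^ J) *
        (y ^ (-(s.re + J)) * (‖θ‖ ^ i * (y ^ i)⁻¹)) := by ring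
    _ ≤ (g * Real.exp (Real.pi * |s.im|) * c ^ (-(s.re + ((J : ℝ) + i))) * ‖θ‖ ^ J) *
        (A ^ (-(s.re + J)) * (1 / ((n : ℝ) + 1) ^ i)) := by gcongr
    _ = _ := by ring

lemma tendsto_powChain {s θ : ℂ} (hs : 1 < s.re) {c A : ℝ} (hc : 0 < c) (hθ : θ ≠ 0) (hA : 0 < A)
    (hcθ : ∀ a t : ℝ, c * (|a| + |t| * ‖θ‖) ≤ ‖(a : ℂ) + t * θ‖) (k : ℕ) {u : ℕ → ℝ}
    (hu : Filter.Tendsto (fun n => |u n|) Filter.atTop Filter.atTop) :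
    Filter.Tendsto (fun n => powChain s θ A k (u n)) Filter.atTop (nhds 0) := by
  have hr : 0 < ‖θ‖ := norm_pos_iff.mpr hθ
  refine squeeze_zero_norm (fun n => norm_powChain_le hs hc hA hcθ k (u n)) ?_
  have hk0 : (0 : ℝ) ≤ k := k.cast_nonneg
  have h1 : Filter.Tendsto (fun n => c * (A + |u n| * ‖θ‖)) Filter.atTop Filter.atTop :=
    (Filter.tendsto_atTop_add_const_left _ A (hu.atTop_mul_const hr)).const_mul_atTop hc
  have h2 := (tendsto_rpow_neg_atTop (y := s.re + ((k : ℝ) - 1)) (by linarith)).comp h1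
  simpa using (h2.const_mul (Real.exp (Real.pi * |s.im|))).const_mul (‖θ‖ ^ ((k : ℤ) - 1) *
      ‖Complex.Gamma (s + ((k : ℂ) - 1)) / Complex.Gamma s‖)

lemma ee_add (a b : ℂ) : ee (a + b) = ee a * ee b := by
  unfold ee
  rw [← Complex.exp_add]; congr 1; ring

/-- Asymptotics of the two half-line sums of `b ↦ e(bν) (A + bθ)^{-s}` over `b ∈ x + ℤ`. -/
lemma exists_halfLine_bound {s : ℂ} (hs : 1 < s.re) (J : ℕ) {c : ℕ → ℂ} {x ν : ℝ}
    (hx : x ∈ Set.Icc (0 : ℝ) 1)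
    (hc : ∀ k : ℕ, ee ν * ∑ i ∈ Finset.range (k + 1),
        c i / (i.factorial : ℂ) * (1 / ((k - i).factorial : ℂ)) - c k / (k.factorial : ℂ) =
      if k = 0 then 0 else ee ((x : ℂ) * ν) * ((x : ℂ) ^ (k - 1) / ((k - 1).factorial : ℂ)))
    {κ : ℝ} (hκ : 0 < κ) :
    ∃ K > 0, ∀ (θ : ℂ) (A : ℝ), θ.im ≠ 0 → ‖θ‖ ≤ A →
      (∀ a t : ℝ, κ * (|a| + |t| * ‖θ‖) ≤ ‖(a : ℂ) + t * θ‖) →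
      ∀ V : ℤ → ℂ, (∀ n : ℤ, V n = ee ((((x + n) * ν : ℝ)) : ℂ) *
        ((A : ℂ) + ((x + n : ℝ) : ℂ) * θ) ^ (-s)) →
      (Summable fun n : ℕ => V n) ∧ (Summable fun n : ℕ => V (-((n : ℤ) + 1))) ∧
      ‖∑' n : ℕ, V n + ∑ k ∈ Finset.range (J + 1),
        c k / (k.factorial : ℂ) * powChain s θ A k 0‖ ≤ K * (‖θ‖ ^ J * A ^ (-(s.re + J))) ∧
      ‖∑' n : ℕ, V (-((n : ℤ) + 1)) - ∑ k ∈ Finset.range (J + 1),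
        c k / (k.factorial : ℂ) * powChain s θ A k 0‖ ≤ K * (‖θ‖ ^ J * A ^ (-(s.re + J))) := by
  set Q : ℕ → ℝ := fun i => ‖Complex.Gamma (s + (((J + 1 + i : ℕ) : ℂ) - 1)) / Complex.Gamma s‖ *
        Real.exp (Real.pi * |s.im|) * κ ^ (-(s.re + ((J : ℝ) + i))) with hQ
  have hQ0 : ∀ i, 0 ≤ Q i := fun i => by positivity
  set b : ℕ → ℂ := fun k => c k / (k.factorial : ℂ) with hb
  set K1 : ℝ := 1 + ∑ k ∈ Finset.range (J + 2 + 1), ‖b k‖ with hK1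
  have hK10 : 0 ≤ K1 := by positivity
  set S : ℝ := ∑' n : ℕ, 1 / ((n : ℝ) + 1) ^ 2 with hS
  have hSsum : Summable fun n : ℕ => 1 / ((n : ℝ) + 1) ^ 2 := by
    have := (summable_nat_add_iff 1).mpr (Real.summable_one_div_nat_pow.mpr one_lt_two)
    simpa using this
  have hS0 : 0 ≤ S := tsum_nonneg fun n => by positivity
  refine ⟨K1 * Q 2 * S + (‖b (J + 1)‖ * Q 0 + ‖b (J + 2)‖ * Q 1) + 1, by positivity, ?_⟩
  intro θ A hθim hθA hcθ V hV
  have hθ : θ ≠ 0 := by rintro rfl; simp at hθim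
  have hr : 0 < ‖θ‖ := norm_pos_iff.mpr hθ
  have hA : 0 < A := hr.trans_le hθA
  set B : ℝ := ‖θ‖ ^ J * A ^ (-(s.re + J)) with hB
  have hB0 : 0 ≤ B := by positivity
  set G := powChain s θ A with hGdef
  have hΓ : Complex.Gamma s ≠ 0 := Complex.Gamma_ne_zero_of_re_pos (by linarith)
  have hVn : ∀ n : ℤ, V n = ee (((n * ν : ℝ)) : ℂ) * (ee ((x : ℂ) * ν) * G 1 (n + x)) := by
    intro n
    have : G 1 (n + x) = ((A : ℂ) + ((x + n : ℝ) : ℂ) * θ) ^ (-s) := by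
      simp [hGdef, powChain, hΓ, add_comm]
    rw [hV, this, ← mul_assoc, ← ee_add]
    congr 2
    push_cast; ring
  have hGderiv : ∀ k t, HasDerivAt (G k) (G (k + 1) t) t := hasDerivAt_powChain hs hθim hA
  set U : ℤ → ℂ := fun n => ee (((n * ν : ℝ)) : ℂ) *
    ∑ k ∈ Finset.range (J + 2 + 1), b k * G k n with hU
  have hstep : ∀ (n : ℤ) (m : ℕ), (∀ t ∈ Set.Icc (n : ℝ) (n + 1), (m : ℝ) ≤ |t|) →
      ‖V n - (U (n + 1) - U n)‖ ≤ K1 * Q 2 * B * (1 / ((m : ℝ) + 1) ^ 2) := by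
    intro n m hm
    have h1 := eulerMaclaurin_step hx hc hGderiv (a := n) (J + 2)
      (fun t ht => norm_powChain_le_of_le_abs hs hκ hθ hθA hcθ J 2 m (hm t ht))
    have h2 : V n - (U (n + 1) - U n) = ee (((n * ν : ℝ)) : ℂ) *
        (ee ((x : ℂ) * ν) * G 1 (n + x) -
      (ee ν * ∑ k ∈ Finset.range (J + 2 + 1), c k / (k.factorial : ℂ) * G k (n + 1) -
        ∑ k ∈ Finset.range (J + 2 + 1), c k / (k.factorial : ℂ) * G k n)) := by
      have h3 : ee ((((n + 1 : ℤ) * ν : ℝ)) : ℂ) = ee (((n * ν : ℝ)) : ℂ) * ee ν := by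
        rw [← ee_add]; congr 1; push_cast; ring
      simp only [hU, hVn, h3, hb]
      push_cast
      ring
    rw [h2, norm_mul, norm_ee_ofReal, one_mul]
    refine h1.trans (le_of_eq ?_)
    simp only [hK1, hQ, hB, hb]
    ring
  have hUtend : ∀ u : ℕ → ℤ, Filter.Tendsto (fun n => |(u n : ℝ)|) Filter.atTop Filter.atTop →
      Filter.Tendsto (fun n => U (u n)) Filter.atTop (nhds 0) := by
    intro u hu
    rw [tendsto_zero_iff_norm_tendsto_zero]
    simp only [hU, norm_mul, norm_ee_ofReal, one_mul]
    rw [← tendsto_zero_iff_norm_tendsto_zero]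
    rw [show (0 : ℂ) = ∑ k ∈ Finset.range (J + 2 + 1), b k * 0 by simp]
    exact tendsto_finsetSum _ fun k _ => (tendsto_powChain hs hκ hθ hA hcθ k hu).const_mul _
  have hVsum : Summable V := by
    refine Summable.of_norm_bounded
      ((summable_one_add_abs_rpow x hs).mul_left
        (Real.exp (Real.pi * |s.im|) * (κ * ‖θ‖) ^ (-s.re))) fun n => ?_
    rw [hV, norm_mul, norm_ee_ofReal, one_mul, mul_assoc, ← Real.mul_rpow (by positivity)
      (by positivity)]
    refine norm_cpow_neg_le_s2 (by positivity) (le_trans ?_ (hcθ A (x + n))) (by linarith)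
    rw [mul_assoc, abs_of_pos hA]
    have : ‖θ‖ * (1 + |x + n|) ≤ A + |x + n| * ‖θ‖ := by linarith
    exact mul_le_mul_of_nonneg_left this hκ.le
  have hs1 : Summable fun n : ℕ => V n := hVsum.comp_injective Nat.cast_injective
  have hs2 : Summable fun n : ℕ => V (-((n : ℤ) + 1)) :=
    hVsum.comp_injective (i := fun n : ℕ => -((n : ℤ) + 1)) fun m n h => by
      simpa using h
  have hU0 : ‖U 0 - ∑ k ∈ Finset.range (J + 1), b k * G k 0‖ ≤
      (‖b (J + 1)‖ * Q 0 + ‖b (J + 2)‖ * Q 1) * B := by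
    have h0 : ∀ i : ℕ, ‖G (J + 1 + i) 0‖ ≤ Q i * B := by
      intro i
      have := norm_powChain_le_of_le_abs hs hκ hθ hθA hcθ J i 0 (t := 0) (by simp)
      refine this.trans (le_of_eq ?_)
      simp [hQ, hB]
    have h1 : U 0 - ∑ k ∈ Finset.range (J + 1), b k * G k 0 =
        b (J + 1) * G (J + 1 + 0) 0 + b (J + 2) * G (J + 1 + 1) 0 := by
      have : ee 0 = 1 := by simp [ee]
      simp [hU, Finset.sum_range_succ, this]
      ring
    rw [h1, show (‖b (J + 1)‖ * Q 0 + ‖b (J + 2)‖ * Q 1) * B =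
      ‖b (J + 1)‖ * (Q 0 * B) + ‖b (J + 2)‖ * (Q 1 * B) by ring]
    refine (norm_add_le _ _).trans (add_le_add ?_ ?_)
    · rw [norm_mul]; exact mul_le_mul_of_nonneg_left (h0 0) (norm_nonneg _)
    · rw [norm_mul]; exact mul_le_mul_of_nonneg_left (h0 1) (norm_nonneg _)
  have hEsum := hSsum.mul_left (K1 * Q 2 * B)
  have hE : ∑' n : ℕ, K1 * Q 2 * B * (1 / ((n : ℝ) + 1) ^ 2) = K1 * Q 2 * S * B := by
    rw [tsum_mul_left]; ring
  refine ⟨hs1, hs2, ?_, ?_⟩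
  · have h := norm_tsum_add_le_of_telescope (U := fun n : ℕ => U n) hs1 hEsum
      (hUtend (fun n => n) (by
        simpa using (tendsto_natCast_atTop_atTop (R := ℝ))))
      (fun n => by
        have := hstep n n (fun t ht => by
          have h1 : (n : ℝ) ≤ t := by simpa using ht.1
          exact h1.trans (le_abs_self t))
        simpa using this)
    rw [hE] at h
    have h3 : ∑' n : ℕ, V n + ∑ k ∈ Finset.range (J + 1), b k * G k 0 =
        (∑' n : ℕ, V n + U 0) - (U 0 - ∑ k ∈ Finset.range (J + 1), b k * G k 0) := by ring
    rw [h3]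
    refine (norm_sub_le _ _).trans ?_
    have h' : ‖∑' n : ℕ, V n + U 0‖ ≤ K1 * Q 2 * S * B := by simpa using h
    linarith
  · have h := norm_tsum_add_le_of_telescope (U := fun n : ℕ => -U (-n)) hs2 hEsum
      (by
        rw [← neg_zero]
        exact (hUtend (fun n => -n) (by
          simpa using (tendsto_natCast_atTop_atTop (R := ℝ)))).neg)
      (fun n => by
        have := hstep (-((n : ℤ) + 1)) n (fun t ht => by
          have h1 : t ≤ -(n : ℝ) := by
            have := ht.2
            push_cast at this
            linarith
          rw [abs_of_nonpos (h1.trans (by simp))]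
          linarith)
        have h2 : -U (-((n + 1 : ℕ) : ℤ)) - -U (-(n : ℤ)) =
            U (-((n : ℤ) + 1) + 1) - U (-((n : ℤ) + 1)) := by
          rw [show -((n : ℤ) + 1) + 1 = -(n : ℤ) by ring]
          push_cast; ring
        rw [h2]
        exact this)
    rw [hE] at h
    have h3 : ∑' n : ℕ, V (-((n : ℤ) + 1)) - ∑ k ∈ Finset.range (J + 1), b k * G k 0 =
        (∑' n : ℕ, V (-((n : ℤ) + 1)) - U 0) +
          (U 0 - ∑ k ∈ Finset.range (J + 1), b k * G k 0) := by ring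
    rw [h3]
    refine (norm_add_le _ _).trans ?_
    have h' : ‖∑' n : ℕ, V (-((n : ℤ) + 1)) - U 0‖ ≤ K1 * Q 2 * S * B := by
      simpa [sub_eq_add_neg] using h
    linarith

lemma re_pos_of_abs_arg_le {τ : ℂ} {η : ℝ} (hη : 0 < η) (hτ : 0 < ‖τ‖)
    (harg : |Complex.arg τ| ≤ Real.pi / 2 - η) : 0 < τ.re := by
  have : |Complex.arg τ| < Real.pi / 2 := by linarith
  rcases Complex.abs_arg_lt_pi_div_two_iff.mp this with h | h
  · exact h
  · simp [h] at hτ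

lemma le_norm_add_mul_I_mul {τ : ℂ} {η : ℝ} (hη : 0 < η) (hη' : η < Real.pi / 2) (hτ : 0 < ‖τ‖)
    (harg : |Complex.arg τ| ≤ Real.pi / 2 - η) (a t : ℝ) :
    Real.sqrt ((1 - Real.cos η) / 2) * (|a| + |t| * ‖τ‖) ≤ ‖(a : ℂ) + t * (Complex.I * τ)‖ := by
  have hcos : 0 ≤ 1 - Real.cos η := by linarith [Real.cos_le_one η]
  have hcos0 : 0 ≤ Real.cos η := Real.cos_nonneg_of_mem_Icc ⟨by linarith, by linarith⟩
  have him : |τ.im| ≤ ‖τ‖ * Real.cos η := by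
    have h1 : |Real.sin (Complex.arg τ)| ≤ Real.cos η := by
      rw [Real.abs_sin_eq_sin_abs_of_abs_le_pi (Complex.abs_arg_le_pi τ), ← Real.sin_pi_div_two_sub]
      exact Real.sin_le_sin_of_le_of_le_pi_div_two
        (by linarith [abs_nonneg (Complex.arg τ), Real.pi_pos]) (by linarith) harg
    rw [Complex.sin_arg, abs_div, abs_of_pos hτ, div_le_iff₀ hτ] at h1
    linarith
  refine le_of_sq_le_sq ?_ (norm_nonneg _)
  rw [mul_pow, Real.sq_sqrt (by positivity), Complex.sq_norm, Complex.normSq_apply]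
  have hn : ‖τ‖ ^ 2 = τ.re ^ 2 + τ.im ^ 2 := by
    rw [Complex.sq_norm, Complex.normSq_apply]; ring
  simp only [Complex.add_re, Complex.add_im, Complex.mul_re, Complex.mul_im, Complex.ofReal_re,
    Complex.ofReal_im, Complex.I_re, Complex.I_im]
  have hprod : a * t * τ.im ≤ |a| * |t| * (‖τ‖ * Real.cos η) := by
    refine (le_abs_self _).trans ?_
    rw [abs_mul, abs_mul]
    exact mul_le_mul_of_nonneg_left him (by positivity)
  have hsq : (|a| - |t| * ‖τ‖) ^ 2 ≥ 0 := sq_nonneg _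
  have ha : |a| ^ 2 = a ^ 2 := sq_abs a
  have ht : |t| ^ 2 = t ^ 2 := sq_abs t
  have hX : (|a| + |t| * ‖τ‖) ^ 2 + (|a| - |t| * ‖τ‖) ^ 2 = 2 * (a ^ 2 + t ^ 2 * ‖τ‖ ^ 2) := by
    rw [← ha, ← ht]; ring
  have h5 : 2 * (|a| * |t| * ‖τ‖) = a ^ 2 + t ^ 2 * ‖τ‖ ^ 2 - (|a| - |t| * ‖τ‖) ^ 2 := by
    rw [← ha, ← ht]; ring
  have h6 : a ^ 2 + t ^ 2 * ‖τ‖ ^ 2 - 2 * (a * t * τ.im) ≥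
      (1 - Real.cos η) * (a ^ 2 + t ^ 2 * ‖τ‖ ^ 2) := by
    nlinarith [mul_nonneg hcos0 hsq]
  have h7 : (1 - Real.cos η) / 2 * (|a| + |t| * ‖τ‖) ^ 2 ≤
      (1 - Real.cos η) * (a ^ 2 + t ^ 2 * ‖τ‖ ^ 2) := by
    nlinarith [mul_nonneg hcos hsq]
  rw [hn] at h6 h7
  have hring : ∀ u v : ℝ, (a + (t * (0 * u - 1 * v) - 0 * (0 * v + 1 * u))) *
      (a + (t * (0 * u - 1 * v) - 0 * (0 * v + 1 * u))) +
      (0 + (t * (0 * v + 1 * u) + 0 * (0 * u - 1 * v))) *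
      (0 + (t * (0 * v + 1 * u) + 0 * (0 * u - 1 * v))) =
      a ^ 2 + t ^ 2 * (u ^ 2 + v ^ 2) - 2 * (a * t * v) := fun u v => by ring
  rw [hring]
  linarith

lemma neg_cpow_of_im_neg {w : ℂ} (hw : w.im < 0) (p : ℂ) :
    (-w) ^ p = Complex.exp (Real.pi * Complex.I * p) * w ^ p := by
  have hw0 : w ≠ 0 := by rintro rfl; simp at hw
  rw [Complex.cpow_def_of_ne_zero (neg_ne_zero.mpr hw0), Complex.cpow_def_of_ne_zero hw0,
    ← Complex.exp_add]
  congr 1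
  simp only [Complex.log, norm_neg, Complex.arg_neg_eq_arg_add_pi_of_im_neg hw]
  push_cast; ring

lemma neg_cpow_of_im_pos_s2 {w : ℂ} (hw : 0 < w.im) (p : ℂ) :
    (-w) ^ p = Complex.exp (-(Real.pi * Complex.I * p)) * w ^ p := by
  have hw0 : w ≠ 0 := by rintro rfl; simp at hw
  rw [Complex.cpow_def_of_ne_zero (neg_ne_zero.mpr hw0), Complex.cpow_def_of_ne_zero hw0,
    ← Complex.exp_add]
  congr 1
  simp only [Complex.log, norm_neg, Complex.arg_neg_eq_arg_sub_pi_of_im_pos hw]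
  push_cast; ring

lemma ofReal_mul_I_mul_cpow {b : ℝ} (hb : 0 < b) {τ : ℂ} (hτ : 0 < τ.re) (p : ℂ) :
    ((b : ℂ) * (Complex.I * τ)) ^ p =
      Complex.exp (Real.pi * Complex.I * p / 2) * (b : ℂ) ^ p * τ ^ p := by
  have hτ0 : τ ≠ 0 := by rintro rfl; simp at hτ
  have hb0 : (b : ℂ) ≠ 0 := by exact_mod_cast hb.ne'
  have harg := abs_lt.mp (Complex.abs_arg_lt_pi_div_two_iff.mpr (Or.inl hτ))
  rw [Complex.cpow_def_of_ne_zero (mul_ne_zero hb0 (mul_ne_zero Complex.I_ne_zero hτ0)),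
    Complex.cpow_def_of_ne_zero hb0, Complex.cpow_def_of_ne_zero hτ0, ← Complex.exp_add,
    ← Complex.exp_add, Complex.log_ofReal_mul hb (mul_ne_zero Complex.I_ne_zero hτ0),
    Complex.log_mul Complex.I_ne_zero hτ0 (by
      rw [Complex.arg_I]; constructor <;> linarith [Real.pi_pos]), Complex.log_I,
    Complex.ofReal_log hb.le]
  congr 1; ring

lemma ofReal_neg_mul_I_mul_cpow {b : ℝ} (hb : b < 0) {τ : ℂ} (hτ : 0 < τ.re) (p : ℂ) :
    ((b : ℂ) * (Complex.I * τ)) ^ p =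
      Complex.exp (-(Real.pi * Complex.I * p / 2)) * ((|b| : ℝ) : ℂ) ^ p * τ ^ p := by
  have h1 : (b : ℂ) * (Complex.I * τ) = -(((-b : ℝ) : ℂ) * (Complex.I * τ)) := by push_cast; ring
  have h2 : 0 < (((-b : ℝ) : ℂ) * (Complex.I * τ)).im := by
    simpa using mul_neg_of_neg_of_pos hb hτ
  rw [h1, neg_cpow_of_im_pos_s2 h2, ofReal_mul_I_mul_cpow (by linarith) hτ, abs_of_neg hb,
    ← mul_assoc, ← mul_assoc, ← Complex.exp_add]
  congr 3; ring

lemma hasSum_dInt (γ : ℝ) (y : ℂ) :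
    HasSum (fun m : ℤ => if γ + (m : ℝ) = 0 then y else 0) (dInt γ * y) := by
  unfold dInt
  split_ifs with h
  · obtain ⟨n, hn⟩ := h
    have : (fun m : ℤ => if γ + (m : ℝ) = 0 then y else 0) = fun m => if m = -n then y else 0 := by
      ext m
      congr 1
      rw [← hn, eq_iff_iff]
      constructor
      · intro h
        have : n + m = 0 := by exact_mod_cast h
        omega
      · rintro rfl; simp
    rw [this, one_mul]
    exact hasSum_ite_eq _ _
  · have : (fun m : ℤ => if γ + (m : ℝ) = 0 then y else 0) = fun _ => 0 := by
      ext m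
      rw [if_neg]
      intro h0
      exact h ⟨-m, by push_cast; linarith⟩
    rw [this, zero_mul]
    exact hasSum_zero

lemma tsum_subtype_eq_tsum_ite {ι : Type*} (P : ι → Prop) (f : ι → ℂ) :
    ∑' k : {k // P k}, f k.1 = ∑' k, if P k then f k else 0 := by
  have := tsum_subtype {k | P k} f
  refine this.trans (tsum_congr fun k => ?_)
  simp [Set.indicator_apply]

lemma summable_ite_abs_cpow {p : ℂ} (hp : 1 < p.re) (γ κ : ℝ) (P : ℤ → Prop)
    (hP : ∀ k, P k → γ + (k : ℝ) ≠ 0) :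
    Summable fun k : ℤ => if P k then
      ee ((((γ + (k : ℝ)) * κ : ℝ)) : ℂ) * ((|γ + (k : ℝ)| : ℝ) : ℂ) ^ (-p) else 0 := by
  refine Summable.of_norm_bounded ((Real.summable_one_div_int_add_rpow γ p.re).mpr hp) fun k => ?_
  split_ifs with h
  · rw [norm_mul, norm_ee_ofReal, one_mul,
      Complex.norm_cpow_eq_rpow_re_of_pos (abs_pos.mpr (hP k h)), Complex.neg_re,
      Real.rpow_neg (abs_nonneg _), one_div, add_comm]
  · rw [norm_zero]; positivity

lemma hasSum_psiL {p : ℂ} (hp : 1 < p.re) (γ κ : ℝ) :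
    HasSum (fun k : ℤ => if 0 < γ + (k : ℝ) then
      ee ((((γ + (k : ℝ)) * κ : ℝ)) : ℂ) * ((|γ + (k : ℝ)| : ℝ) : ℂ) ^ (-p) else 0)
      (psiL p γ κ) := by
  have h := (summable_ite_abs_cpow hp γ κ (fun k => 0 < γ + (k : ℝ)) fun k hk => hk.ne').hasSum
  convert h using 1
  unfold psiL
  rw [tsum_subtype_eq_tsum_ite (fun k : ℤ => 0 < γ + (k : ℝ))
    (fun k : ℤ => ee ((((γ + (k : ℝ)) * κ : ℝ)) : ℂ) * (((γ + (k : ℝ)) : ℝ) : ℂ) ^ (-p))]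
  refine tsum_congr fun k => ?_
  split_ifs with hk
  · rw [abs_of_pos hk]
  · rfl

lemma hasSum_psiL_neg {p : ℂ} (hp : 1 < p.re) (γ κ : ℝ) :
    HasSum (fun k : ℤ => if γ + (k : ℝ) < 0 then
      ee ((((γ + (k : ℝ)) * κ : ℝ)) : ℂ) * ((|γ + (k : ℝ)| : ℝ) : ℂ) ^ (-p) else 0)
      (psiL p (-γ) (-κ)) := by
  have h := (Equiv.neg ℤ).hasSum_iff.mpr (hasSum_psiL hp (-γ) (-κ))
  convert h using 1
  ext k
  have h1 : -γ + ((-k : ℤ) : ℝ) = -(γ + k) := by push_cast; ring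
  simp only [Function.comp, Equiv.neg_apply, h1, Left.neg_pos_iff, abs_neg, neg_mul_neg]

/-- Summation over `β + ℤ` split at the origin, with a different weight on each half-line. -/
lemma hasSum_of_halfLines {β : ℝ} {V f : ℤ → ℂ} {ω₁ ω₂ y : ℂ}
    (h₁ : Summable fun n : ℕ => V n) (h₂ : Summable fun n : ℕ => V (-((n : ℤ) + 1)))
    (hf : ∀ n : ℤ, f n = (if 0 ≤ n + ⌊β⌋ then ω₁ else ω₂) * V (n + ⌊β⌋) -
      if β + (n : ℝ) = 0 then y else 0) :
    HasSum f (ω₁ * ∑' n : ℕ, V n + ω₂ * ∑' n : ℕ, V (-((n : ℤ) + 1)) - dInt β * y) := by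
  have hW : HasSum (fun n : ℤ => (if 0 ≤ n then ω₁ else ω₂) * V n)
      (ω₁ * ∑' n : ℕ, V n + ω₂ * ∑' n : ℕ, V (-((n : ℤ) + 1))) := by
    refine HasSum.of_nat_of_neg_add_one ?_ ?_
    · simpa using h₁.hasSum.mul_left ω₁
    · convert! h₂.hasSum.mul_left ω₂ using 1
  have h := ((Equiv.addRight ⌊β⌋).hasSum_iff.mpr hW).sub (hasSum_dInt β y)
  convert! h using 1
  ext n
  simp [hf]

lemma exists_row_bound_pos {s : ℂ} (hs : 1 < s.re) (J : ℕ) {c : ℕ → ℂ} {β ν : ℝ}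
    (hc : ∀ k : ℕ, ee ν * ∑ i ∈ Finset.range (k + 1),
        c i / (i.factorial : ℂ) * (1 / ((k - i).factorial : ℂ)) - c k / (k.factorial : ℂ) =
      if k = 0 then 0 else ee (((Int.fract β : ℝ) : ℂ) * ν) *
        (((Int.fract β : ℝ) : ℂ) ^ (k - 1) / ((k - 1).factorial : ℂ)))
    {κ : ℝ} (hκ : 0 < κ) :
    ∃ K > 0, ∀ (τ : ℂ) (A : ℝ), 0 < τ.re → ‖τ‖ ≤ A →
      (∀ a t : ℝ, κ * (|a| + |t| * ‖τ‖) ≤ ‖(a : ℂ) + t * (Complex.I * τ)‖) →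
      ‖∑' n : ℤ, (if β + (n : ℝ) ≠ 0 then ee ((((β + (n : ℝ)) * ν : ℝ)) : ℂ) *
          ((A : ℂ) + ((β + (n : ℝ) : ℝ) : ℂ) * (Complex.I * τ)) ^ (-s) else 0) +
        dInt β * (A : ℂ) ^ (-s)‖ ≤ K * (‖τ‖ ^ J * A ^ (-(s.re + J))) := by
  obtain ⟨K, hK, H⟩ := exists_halfLine_bound hs J
    ⟨Int.fract_nonneg β, (Int.fract_lt_one β).le⟩ hc hκ
  refine ⟨2 * K, by positivity, fun τ A hτ hτA hcτ => ?_⟩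
  have hnI : ‖Complex.I * τ‖ = ‖τ‖ := by simp
  obtain ⟨V, hV⟩ : ∃ V : ℤ → ℂ, ∀ n : ℤ, V n = ee ((((Int.fract β + n) * ν : ℝ)) : ℂ) *
      ((A : ℂ) + ((Int.fract β + n : ℝ) : ℂ) * (Complex.I * τ)) ^ (-s) := ⟨_, fun _ => rfl⟩
  obtain ⟨h1, h2, h3, h4⟩ := H (Complex.I * τ) A (by simpa using hτ.ne') (by rwa [hnI])
    (by rwa [hnI]) V hV
  have hsum := hasSum_of_halfLines (β := β) (ω₁ := 1) (ω₂ := 1) (y := (A : ℂ) ^ (-s))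
    (f := fun n : ℤ => if β + (n : ℝ) ≠ 0 then ee ((((β + (n : ℝ)) * ν : ℝ)) : ℂ) *
          ((A : ℂ) + ((β + (n : ℝ) : ℝ) : ℂ) * (Complex.I * τ)) ^ (-s) else 0) h1 h2 (by
      intro n
      have hb : Int.fract β + ((n + ⌊β⌋ : ℤ) : ℝ) = β + n := by
        rw [Int.fract]; push_cast; ring
      simp only [hV, hb, ite_self, one_mul]
      by_cases h0 : β + (n : ℝ) = 0
      · simp [h0, ee]
      · simp [h0])
  rw [hnI] at h3 h4
  rw [hsum.tsum_eq]
  generalize (∑ k ∈ Finset.range (J + 1),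
    c k / (k.factorial : ℂ) * powChain s (Complex.I * τ) A k 0) = U at h3 h4
  refine le_trans (le_of_eq ?_) ((norm_add_le _ _).trans (add_le_add h3 h4)) |>.trans
    (le_of_eq (by ring))
  congr 1
  ring

lemma exists_row_bound_neg {s : ℂ} (hs : 1 < s.re) (J : ℕ) {c : ℕ → ℂ} {β ν : ℝ}
    (hc : ∀ k : ℕ, ee ν * ∑ i ∈ Finset.range (k + 1),
        c i / (i.factorial : ℂ) * (1 / ((k - i).factorial : ℂ)) - c k / (k.factorial : ℂ) =
      if k = 0 then 0 else ee (((Int.fract β : ℝ) : ℂ) * ν) *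
        (((Int.fract β : ℝ) : ℂ) ^ (k - 1) / ((k - 1).factorial : ℂ)))
    {κ : ℝ} (hκ : 0 < κ) :
    ∃ K > 0, ∀ (τ : ℂ) (A : ℝ), 0 < τ.re → ‖τ‖ ≤ A →
      (∀ a t : ℝ, κ * (|a| + |t| * ‖τ‖) ≤ ‖(a : ℂ) + t * (Complex.I * τ)‖) →
      ‖∑' n : ℤ, (if β + (n : ℝ) ≠ 0 then ee ((((β + (n : ℝ)) * ν : ℝ)) : ℂ) *
          (-(A : ℂ) + ((β + (n : ℝ) : ℝ) : ℂ) * (Complex.I * τ)) ^ (-s) else 0) +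
        dInt β * (Complex.cos (Real.pi * s) * (A : ℂ) ^ (-s)) -
        (2 * Complex.I * Complex.sin (Real.pi * s) * ∑ k ∈ Finset.range (J + 1),
          c k / (k.factorial : ℂ) * powChain s (-(Complex.I * τ)) A k 0 +
        dInt β * (Complex.I * Complex.sin (Real.pi * s) * (A : ℂ) ^ (-s)))‖ ≤
      K * (‖τ‖ ^ J * A ^ (-(s.re + J))) := by
  obtain ⟨K, hK, H⟩ := exists_halfLine_bound hs J
    ⟨Int.fract_nonneg β, (Int.fract_lt_one β).le⟩ hc hκ
  set ω₁ := Complex.cos (Real.pi * s) - Complex.I * Complex.sin (Real.pi * s) with hω₁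
  set ω₂ := Complex.cos (Real.pi * s) + Complex.I * Complex.sin (Real.pi * s) with hω₂
  have hexp₁ : Complex.exp (Real.pi * Complex.I * (-s)) = ω₁ := by
    rw [show (Real.pi : ℂ) * Complex.I * (-s) = (-(Real.pi * s)) * Complex.I by ring,
      Complex.exp_mul_I, Complex.cos_neg, Complex.sin_neg]
    ring
  have hexp₂ : Complex.exp (-(Real.pi * Complex.I * (-s))) = ω₂ := by
    rw [show -((Real.pi : ℂ) * Complex.I * (-s)) = (Real.pi * s) * Complex.I by ring,
      Complex.exp_mul_I]
    ring
  refine ⟨(‖ω₁‖ + ‖ω₂‖) * K + 1, by positivity, fun τ A hτ hτA hcτ => ?_⟩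
  have hnI : ‖-(Complex.I * τ)‖ = ‖τ‖ := by simp
  have hA : 0 ≤ A := (norm_nonneg _).trans hτA
  obtain ⟨V, hV⟩ : ∃ V : ℤ → ℂ, ∀ n : ℤ, V n = ee ((((Int.fract β + n) * ν : ℝ)) : ℂ) *
      ((A : ℂ) + ((Int.fract β + n : ℝ) : ℂ) * -(Complex.I * τ)) ^ (-s) := ⟨_, fun _ => rfl⟩
  obtain ⟨h1, h2, h3, h4⟩ := H (-(Complex.I * τ)) A (by simpa using hτ.ne') (by rwa [hnI])
    (by
      intro a t
      have := hcτ a (-t)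
      rw [hnI]
      simpa using this) V hV
  have hsum := hasSum_of_halfLines (β := β) (ω₁ := ω₁) (ω₂ := ω₂) (y := ω₁ * (A : ℂ) ^ (-s))
    (f := fun n : ℤ => if β + (n : ℝ) ≠ 0 then ee ((((β + (n : ℝ)) * ν : ℝ)) : ℂ) *
          (-(A : ℂ) + ((β + (n : ℝ) : ℝ) : ℂ) * (Complex.I * τ)) ^ (-s) else 0) h1 h2 (by
      intro n
      have hb : Int.fract β + ((n + ⌊β⌋ : ℤ) : ℝ) = β + n := by
        rw [Int.fract]; push_cast; ring
      have hneg : -(A : ℂ) + ((β + (n : ℝ) : ℝ) : ℂ) * (Complex.I * τ) =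
          -((A : ℂ) + ((β + (n : ℝ) : ℝ) : ℂ) * -(Complex.I * τ)) := by ring
      have him : ((A : ℂ) + ((β + (n : ℝ) : ℝ) : ℂ) * -(Complex.I * τ)).im = -((β + n) * τ.re) := by
        simp [-Complex.ofReal_add]
      have hfl := Int.fract_lt_one β
      have hfn := Int.fract_nonneg β
      simp only [hV, hb]
      by_cases hn : 0 ≤ n + ⌊β⌋
      · have hn' : (0 : ℝ) ≤ ((n + ⌊β⌋ : ℤ) : ℝ) := by exact_mod_cast hn
        rw [if_pos hn]
        by_cases h0 : β + (n : ℝ) = 0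
        · simp [h0, ee]
        · have hbpos : 0 < β + (n : ℝ) := lt_of_le_of_ne (by linarith) (Ne.symm h0)
          rw [if_pos h0, if_neg h0, hneg,
            neg_cpow_of_im_neg (by rw [him]; linarith [mul_pos hbpos hτ]), hexp₁]
          ring
      · have hn' : ((n + ⌊β⌋ : ℤ) : ℝ) ≤ -1 := by
          have : n + ⌊β⌋ ≤ -1 := by omega
          exact_mod_cast this
        have hbneg : β + (n : ℝ) < 0 := by linarith
        rw [if_neg hn, if_pos hbneg.ne, if_neg hbneg.ne, hneg,
          neg_cpow_of_im_pos_s2 (by rw [him]; linarith [mul_neg_of_neg_of_pos hbneg hτ]), hexp₂]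
        ring)
  rw [hsum.tsum_eq]
  rw [hnI] at h3 h4
  generalize (∑ k ∈ Finset.range (J + 1),
    c k / (k.factorial : ℂ) * powChain s (-(Complex.I * τ)) A k 0) = U at h3 h4 ⊢
  set B := ‖τ‖ ^ J * A ^ (-(s.re + J)) with hB
  have hB0 : 0 ≤ B := by positivity
  have hfin := (norm_add_le _ _).trans (add_le_add
    ((norm_mul_le ω₁ _).trans (mul_le_mul_of_nonneg_left h3 (norm_nonneg ω₁)))
    ((norm_mul_le ω₂ _).trans (mul_le_mul_of_nonneg_left h4 (norm_nonneg ω₂))))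
  refine le_trans (le_of_eq ?_) (hfin.trans (by linarith))
  congr 1
  rw [hω₁, hω₂]
  ring

lemma tsum_row_zero {s : ℂ} (hs : 1 < s.re) (β ν : ℝ) {τ : ℂ} (hτ : 0 < τ.re) :
    ∑' n : ℤ, (if β + (n : ℝ) ≠ 0 then ee ((((β + (n : ℝ)) * ν : ℝ)) : ℂ) *
          (((β + (n : ℝ) : ℝ) : ℂ) * (Complex.I * τ)) ^ (-s) else 0) =
      (Complex.exp ((Real.pi : ℂ) * Complex.I * s / 2) * psiL s (-β) (-ν) +
        Complex.exp (-((Real.pi : ℂ) * Complex.I * s) / 2) * psiL s β ν) * τ ^ (-s) := by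
  refine HasSum.tsum_eq ?_
  convert! (((hasSum_psiL_neg hs β ν).mul_left
    (Complex.exp ((Real.pi : ℂ) * Complex.I * s / 2))).add ((hasSum_psiL hs β ν).mul_left
    (Complex.exp (-((Real.pi : ℂ) * Complex.I * s) / 2)))).mul_right (τ ^ (-s)) using 1
  ext n
  rcases lt_trichotomy (β + (n : ℝ)) 0 with h | h | h
  · rw [if_pos h.ne, if_pos h, if_neg h.not_gt, ofReal_neg_mul_I_mul_cpow h hτ]
    rw [show -((Real.pi : ℂ) * Complex.I * -s / 2) = (Real.pi : ℂ) * Complex.I * s / 2 by ring]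
    ring
  · simp [h]
  · rw [if_pos h.ne', if_pos h, if_neg h.not_gt, ofReal_mul_I_mul_cpow h hτ, abs_of_pos h]
    rw [show (Real.pi : ℂ) * Complex.I * -s / 2 = -((Real.pi : ℂ) * Complex.I * s) / 2 by ring]
    ring

lemma exists_pos_le_abs_add_int (γ : ℝ) :
    ∃ ε > 0, ∀ n : ℤ, γ + (n : ℝ) ≠ 0 → ε ≤ |γ + (n : ℝ)| := by
  have key : ∀ n : ℤ, 0 < γ + (n : ℝ) → Int.fract γ ≤ γ + (n : ℝ) := by
    intro n hn
    have h1 : Int.fract (γ + n) = Int.fract γ := Int.fract_add_intCast γ n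
    have h2 : (0 : ℝ) ≤ ⌊γ + n⌋ := by exact_mod_cast Int.floor_nonneg.mpr hn.le
    have h3 := Int.floor_add_fract (γ + (n : ℝ))
    linarith
  have key' : ∀ n : ℤ, γ + (n : ℝ) < 0 → 1 - Int.fract γ ≤ -(γ + (n : ℝ)) := by
    intro n hn
    have h1 : Int.fract (γ + n) = Int.fract γ := Int.fract_add_intCast γ n
    have h2 : (⌊γ + n⌋ : ℝ) ≤ -1 := by
      have : ⌊γ + n⌋ < 0 := Int.floor_lt.mpr (by simpa using hn)
      exact_mod_cast (by omega : ⌊γ + n⌋ ≤ -1)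
    have h3 := Int.floor_add_fract (γ + (n : ℝ))
    linarith
  have hlt := Int.fract_lt_one γ
  rcases (Int.fract_nonneg γ).eq_or_lt with h0 | h0
  · refine ⟨1, one_pos, fun n hn => ?_⟩
    have hfl := Int.floor_add_fract γ
    have hint : γ + (n : ℝ) = ((⌊γ⌋ + n : ℤ) : ℝ) := by push_cast; linarith
    rw [hint] at hn ⊢
    have : ⌊γ⌋ + n ≠ 0 := by exact_mod_cast hn
    exact_mod_cast Int.one_le_abs this
  · refine ⟨min (Int.fract γ) (1 - Int.fract γ), lt_min h0 (by linarith), fun n hn => ?_⟩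
    rcases lt_or_gt_of_ne hn with h | h
    · rw [abs_of_neg h]; exact (min_le_right _ _).trans (key' n h)
    · rw [abs_of_pos h]; exact (min_le_left _ _).trans (key n h)

lemma summable_lattice {s : ℂ} (hs : 2 < s.re) (α β μ ν : ℝ) {τ : ℂ} (hτ : 0 < ‖τ‖) {κ : ℝ}
    (hκ : 0 < κ)
    (hcτ : ∀ a t : ℝ, κ * (|a| + |t| * ‖τ‖) ≤ ‖(a : ℂ) + t * (Complex.I * τ)‖) :
    Summable fun p : ℤ × ℤ => if β + (p.2 : ℝ) ≠ 0 then
      ee ((((α + (p.1 : ℝ)) * μ + (β + (p.2 : ℝ)) * ν : ℝ)) : ℂ) *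
        ((((α + (p.1 : ℝ)) : ℝ) : ℂ) + (((β + (p.2 : ℝ)) : ℝ) : ℂ) * (Complex.I * τ)) ^ (-s)
      else 0 := by
  obtain ⟨ε, hε, hεβ⟩ := exists_pos_le_abs_add_int β
  set d : ℝ := min 1 (min (‖τ‖ * ε / 2) (‖τ‖ / 2)) with hd
  have hd0 : 0 < d := by positivity
  have hd1 : d ≤ 1 := min_le_left _ _
  have hd2 : d ≤ ‖τ‖ * ε / 2 := (min_le_right _ _).trans (min_le_left _ _)
  have hd3 : d ≤ ‖τ‖ / 2 := (min_le_right _ _).trans (min_le_right _ _)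
  have hp : 1 < s.re / 2 := by linarith
  have hsum := (summable_one_add_abs_rpow α hp).mul_of_nonneg (summable_one_add_abs_rpow β hp)
    (fun n => by positivity) (fun n => by positivity)
  refine Summable.of_norm_bounded
    (hsum.mul_left (Real.exp (Real.pi * |s.im|) * (κ * d) ^ (-s.re))) fun p => ?_
  split_ifs with h
  · rw [norm_mul, norm_ee_ofReal, one_mul]
    set a := α + (p.1 : ℝ)
    set b := β + (p.2 : ℝ)
    have hb := hεβ p.2 h
    have hy0 : 0 < 1 + |a| + |b| := by positivity
    have hle : κ * d * (1 + |a| + |b|) ≤ κ * (|a| + |b| * ‖τ‖) := by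
      rw [mul_assoc]
      refine mul_le_mul_of_nonneg_left ?_ hκ.le
      have h1 : d * |a| ≤ |a| := by nlinarith [abs_nonneg a]
      have h2 : d * |b| ≤ ‖τ‖ / 2 * |b| := mul_le_mul_of_nonneg_right hd3 (abs_nonneg b)
      have h3 : ‖τ‖ * ε / 2 ≤ ‖τ‖ / 2 * |b| := by nlinarith
      nlinarith
    refine (norm_cpow_neg_le_s2 (by positivity) (hle.trans (hcτ a b)) (by linarith)).trans ?_
    rw [Real.mul_rpow (by positivity) hy0.le, mul_assoc]
    refine mul_le_mul_of_nonneg_left (mul_le_mul_of_nonneg_left ?_ (by positivity)) (by positivity)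
    rw [← Real.mul_rpow (by positivity) (by positivity)]
    have hsq : (1 + |a| + |b|) ^ (-s.re) = ((1 + |a| + |b|) ^ (2 : ℝ)) ^ (-(s.re / 2)) := by
      rw [← Real.rpow_mul hy0.le]; congr 1; ring
    rw [hsq, Real.rpow_two]
    refine Real.rpow_le_rpow_of_nonpos (by positivity) ?_ (by linarith)
    nlinarith [abs_nonneg a, abs_nonneg b, mul_nonneg (abs_nonneg a) (abs_nonneg b)]
  · rw [norm_zero]; positivity

lemma hasSum_Fz2_rows {s : ℂ} (hs : 2 < s.re) (α β μ ν : ℝ) {τ : ℂ} (hτ : 0 < ‖τ‖) {κ : ℝ}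
    (hκ : 0 < κ)
    (hcτ : ∀ a t : ℝ, κ * (|a| + |t| * ‖τ‖) ≤ ‖(a : ℂ) + t * (Complex.I * τ)‖) :
    HasSum (fun m : ℤ =>
      ee ((((α + (m : ℝ)) * μ : ℝ)) : ℂ) *
        (∑' n : ℤ, if β + (n : ℝ) ≠ 0 then ee ((((β + (n : ℝ)) * ν : ℝ)) : ℂ) *
          ((((α + (m : ℝ)) : ℝ) : ℂ) + ((β + (n : ℝ) : ℝ) : ℂ) * (Complex.I * τ)) ^ (-s) else 0) +
      dInt β * ((if 0 < α + (m : ℝ) then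
          ee ((((α + (m : ℝ)) * μ : ℝ)) : ℂ) * ((|α + (m : ℝ)| : ℝ) : ℂ) ^ (-s) else 0) +
        Complex.cos (Real.pi * s) * (if α + (m : ℝ) < 0 then
          ee ((((α + (m : ℝ)) * μ : ℝ)) : ℂ) * ((|α + (m : ℝ)| : ℝ) : ℂ) ^ (-s) else 0)))
      (Fz2 s α β μ ν (Complex.I * τ)) := by
  have hsum := summable_lattice hs α β μ ν hτ hκ hcτ
  have hfib := hsum.hasSum.prod_fiberwise fun m => (hsum.prod_factor m).hasSum
  have hs1 : 1 < s.re := by linarith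
  have h := hfib.add (((hasSum_psiL hs1 α μ).add
    ((hasSum_psiL_neg hs1 α μ).mul_left (Complex.cos (Real.pi * s)))).mul_left (dInt β))
  convert! h using 1
  · ext m
    congr 1
    rw [← tsum_mul_left]
    refine tsum_congr fun n => ?_
    split_ifs with hn
    · simp only [Complex.ofReal_add ((α + (m : ℝ)) * μ), ee_add, mul_assoc]
    · rw [mul_zero]
  · unfold Fz2
    rw [tsum_subtype_eq_tsum_ite (fun p : ℤ × ℤ => β + (p.2 : ℝ) ≠ 0) (fun p : ℤ × ℤ =>
        ee ((((α + (p.1 : ℝ)) * μ + (β + (p.2 : ℝ)) * ν : ℝ)) : ℂ) *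
        ((((α + (p.1 : ℝ)) : ℝ) : ℂ) + (((β + (p.2 : ℝ)) : ℝ) : ℂ) * (Complex.I * τ)) ^ (-s)),
      tsum_subtype_eq_tsum_ite (fun m : ℤ => α + (m : ℝ) < 0) (fun m : ℤ =>
        ee ((((α + (m : ℝ)) * μ : ℝ)) : ℂ) * ((|α + (m : ℝ)| : ℝ) : ℂ) ^ (-s)),
      (hasSum_psiL_neg hs1 α μ).tsum_eq]
    refine congrArg₂ _ (tsum_congr fun p => ?_) rfl
    congr

lemma hasSum_main_rows {s : ℂ} (hs : 2 < s.re) (α μ : ℝ) (J : ℕ) (x y w : ℂ) (c g : ℕ → ℂ) :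
    HasSum (fun m : ℤ =>
      x * (if α + (m : ℝ) < 0 then
          ee ((((α + (m : ℝ)) * μ : ℝ)) : ℂ) * ((|α + (m : ℝ)| : ℝ) : ℂ) ^ (-s) else 0) +
      (if α + (m : ℝ) = 0 then y else 0) +
      w * ∑ i ∈ Finset.range (J + 1), g i * (if α + (m : ℝ) < 0 then
          ee ((((α + (m : ℝ)) * μ : ℝ)) : ℂ) *
            ((|α + (m : ℝ)| : ℝ) : ℂ) ^ (-(s + ((i : ℂ) - 1))) else 0) * c i)
      (x * psiL s (-α) (-μ) + dInt α * y +
        w * ∑ i ∈ Finset.range (J + 1), g i * psiL (s + ((i : ℂ) - 1)) (-α) (-μ) * c i) := by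
  refine (((hasSum_psiL_neg (by linarith) α μ).mul_left x).add (hasSum_dInt α y)).add
    ((hasSum_sum fun i _ => ?_).mul_left w)
  refine ((hasSum_psiL_neg ?_ α μ).mul_left (g i)).mul_right (c i)
  simp only [Complex.add_re, Complex.sub_re, Complex.natCast_re, Complex.one_re]
  have : (0 : ℝ) ≤ i := Nat.cast_nonneg i
  linarith

lemma I_mul_powChain_zero (s τ : ℂ) (A : ℝ) (i : ℕ) :
    Complex.I * powChain s (-(Complex.I * τ)) A i 0 =
      Complex.I ^ i * (Complex.Gamma (s + ((i : ℂ) - 1)) / Complex.Gamma s) *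
        (A : ℂ) ^ (-(s + ((i : ℂ) - 1))) * τ ^ ((i : ℤ) - 1) := by
  have hI : Complex.I * Complex.I ^ ((i : ℤ) - 1) = Complex.I ^ i := by
    rw [mul_comm, ← zpow_add_one₀ Complex.I_ne_zero, sub_add_cancel, zpow_natCast]
  simp only [powChain, neg_neg, Complex.ofReal_zero, zero_mul, add_zero, mul_zpow]
  rw [← hI]
  ring

lemma norm_row_sub_main_le {s : ℂ} (hs : 1 < s.re) (J : ℕ) {c : ℕ → ℂ} {β ν : ℝ}
    (hc : ∀ k : ℕ, ee ν * ∑ i ∈ Finset.range (k + 1),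
        c i / (i.factorial : ℂ) * (1 / ((k - i).factorial : ℂ)) - c k / (k.factorial : ℂ) =
      if k = 0 then 0 else ee (((Int.fract β : ℝ) : ℂ) * ν) *
        (((Int.fract β : ℝ) : ℂ) ^ (k - 1) / ((k - 1).factorial : ℂ)))
    {κ : ℝ} (hκ : 0 < κ) :
    ∃ K > 0, ∀ (τ : ℂ) (a μ : ℝ), 0 < τ.re → (a ≠ 0 → ‖τ‖ ≤ |a|) →
      (∀ a t : ℝ, κ * (|a| + |t| * ‖τ‖) ≤ ‖(a : ℂ) + t * (Complex.I * τ)‖) →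
      ‖(ee (((a * μ : ℝ)) : ℂ) *
        (∑' n : ℤ, if β + (n : ℝ) ≠ 0 then ee ((((β + (n : ℝ)) * ν : ℝ)) : ℂ) *
          ((a : ℂ) + ((β + (n : ℝ) : ℝ) : ℂ) * (Complex.I * τ)) ^ (-s) else 0) +
        dInt β * ((if 0 < a then ee (((a * μ : ℝ)) : ℂ) * ((|a| : ℝ) : ℂ) ^ (-s) else 0) +
          Complex.cos (Real.pi * s) *
            (if a < 0 then ee (((a * μ : ℝ)) : ℂ) * ((|a| : ℝ) : ℂ) ^ (-s) else 0))) -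
        (dInt β * (Complex.I * Complex.sin (Real.pi * s)) *
          (if a < 0 then ee (((a * μ : ℝ)) : ℂ) * ((|a| : ℝ) : ℂ) ^ (-s) else 0) +
        (if a = 0 then (Complex.exp ((Real.pi : ℂ) * Complex.I * s / 2) * psiL s (-β) (-ν) +
          Complex.exp (-((Real.pi : ℂ) * Complex.I * s) / 2) * psiL s β ν) * τ ^ (-s) else 0) +
        2 * Complex.sin (Real.pi * s) * ∑ i ∈ Finset.range (J + 1),
          Complex.I ^ i * (Complex.Gamma (s + ((i : ℂ) - 1)) / Complex.Gamma s) /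
            (Nat.factorial i : ℂ) *
          (if a < 0 then ee (((a * μ : ℝ)) : ℂ) *
            ((|a| : ℝ) : ℂ) ^ (-(s + ((i : ℂ) - 1))) else 0) * (c i * τ ^ ((i : ℤ) - 1)))‖ ≤
      K * (‖τ‖ ^ J * |a| ^ (-(s.re + J))) := by
  obtain ⟨K₁, hK₁, H₁⟩ := exists_row_bound_pos hs J hc hκ
  obtain ⟨K₂, hK₂, H₂⟩ := exists_row_bound_neg hs J hc hκ
  refine ⟨K₁ + K₂, by positivity, fun τ a μ hτ hle hcτ => ?_⟩
  have hB : 0 ≤ ‖τ‖ ^ J * |a| ^ (-(s.re + J)) := by positivity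
  have hee : ∀ w : ℂ, ‖ee (((a * μ : ℝ)) : ℂ) * w‖ = ‖w‖ := fun w => by
    rw [norm_mul, norm_ee_ofReal, one_mul]
  rcases lt_trichotomy a 0 with ha | ha | ha
  · have h := H₂ τ |a| hτ (hle ha.ne) hcτ
    have habs : -((|a| : ℝ) : ℂ) = a := by rw [abs_of_neg ha]; push_cast; ring
    rw [habs] at h
    refine le_trans (le_of_eq ?_) (h.trans (mul_le_mul_of_nonneg_right (by linarith) hB))
    refine Eq.trans ?_ (hee _)
    simp only [if_pos ha, if_neg ha.ne, if_neg ha.not_gt]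
    have hterm : Complex.I * ∑ k ∈ Finset.range (J + 1),
          c k / (k.factorial : ℂ) * powChain s (-(Complex.I * τ)) |a| k 0 =
        ∑ i ∈ Finset.range (J + 1),
          Complex.I ^ i * (Complex.Gamma (s + ((i : ℂ) - 1)) / Complex.Gamma s) /
            (Nat.factorial i : ℂ) *
            ((|a| : ℝ) : ℂ) ^ (-(s + ((i : ℂ) - 1))) * (c i * τ ^ ((i : ℤ) - 1)) := by
      rw [Finset.mul_sum]
      refine Finset.sum_congr rfl fun i _ => ?_
      rw [mul_left_comm, I_mul_powChain_zero s τ]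
      ring
    have hee_sum : ∑ i ∈ Finset.range (J + 1),
          Complex.I ^ i * (Complex.Gamma (s + ((i : ℂ) - 1)) / Complex.Gamma s) /
            (Nat.factorial i : ℂ) * (ee (((a * μ : ℝ)) : ℂ) *
            ((|a| : ℝ) : ℂ) ^ (-(s + ((i : ℂ) - 1)))) * (c i * τ ^ ((i : ℤ) - 1)) =
        ee (((a * μ : ℝ)) : ℂ) * (Complex.I * ∑ k ∈ Finset.range (J + 1),
          c k / (k.factorial : ℂ) * powChain s (-(Complex.I * τ)) |a| k 0) := by
      rw [hterm, Finset.mul_sum]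
      exact Finset.sum_congr rfl fun i _ => by ring
    rw [hee_sum]
    congr 1
    ring
  · subst ha
    have h0 : ee ((((0 : ℝ) * μ : ℝ)) : ℂ) = 1 := by simp [ee]
    rw [h0]
    simp only [lt_irrefl, if_false, if_true, Complex.ofReal_zero, zero_add, mul_zero, zero_mul,
      Finset.sum_const_zero, add_zero, one_mul]
    rw [tsum_row_zero hs β ν hτ, sub_self, norm_zero]
    exact mul_nonneg (by linarith) hB
  · have h := H₁ τ |a| hτ (hle ha.ne') hcτ
    refine le_trans (le_of_eq ?_) (h.trans (mul_le_mul_of_nonneg_right (by linarith) hB))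
    refine Eq.trans ?_ (hee _)
    simp only [if_pos ha, if_neg ha.ne', if_neg ha.not_gt, abs_of_pos ha, mul_zero, zero_mul,
      Finset.sum_const_zero, add_zero, sub_zero]
    congr 1
    ring

/-- Theorem 2 of the paper: asymptotic expansion of `F_{ℤ²}(s;α,β;μ,ν;iτ)` as `τ → 0`
in the sector `|arg τ| ≤ π/2 - η`, with remainder `O(|τ|^J)`.  The family `C`
is the family of coefficients `𝒞_k(X,κ)`, characterized by the Taylor expansion
`Z e(Xκ) e^{XZ}/(e(κ)e^Z - 1) = Σ_k 𝒞_k(X,κ) Z^k/k!` near `Z = 0`. -/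
theorem statement2 (α β μ ν : ℝ) (s : ℂ) (hs : 2 < s.re) (J : ℕ) (η : ℝ)
    (hη : 0 < η) (hη' : η < Real.pi / 2)
    (C : ℕ → ℂ → ℝ → ℂ)
    (hC : ∀ (X : ℂ) (κ : ℝ), ∀ᶠ Z in nhdsWithin (0 : ℂ) {(0 : ℂ)}ᶜ,
      HasSum (fun j : ℕ => C j X κ * Z ^ j / (Nat.factorial j : ℂ))
        (Z * ee (X * (κ : ℂ)) * Complex.exp (X * Z) / (ee ((κ : ℝ) : ℂ) * Complex.exp Z - 1))) :
    ∃ c > 0, ∃ δ₀ > 0, ∀ τ : ℂ, 0 < ‖τ‖ → ‖τ‖ ≤ δ₀ → |Complex.arg τ| ≤ Real.pi / 2 - η →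
      ‖Fz2 s α β μ ν (Complex.I * τ) -
          dInt β * (Complex.I * Complex.sin ((Real.pi : ℂ) * s) * psiL s (-α) (-μ)) -
          dInt α * (Complex.exp ((Real.pi : ℂ) * Complex.I * s / 2) * psiL s (-β) (-ν) +
              Complex.exp (-((Real.pi : ℂ) * Complex.I * s) / 2) * psiL s β ν) * τ ^ (-s) -
          2 * Complex.sin ((Real.pi : ℂ) * s) *
            ∑ i ∈ Finset.range (J + 1),
              Complex.I ^ i * (Complex.Gamma (s + ((i : ℂ) - 1)) / Complex.Gamma s) /
                  (Nat.factorial i : ℂ) *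
                psiL (s + ((i : ℂ) - 1)) (-α) (-μ) *
                C i ((Int.fract β : ℝ) : ℂ) ν * τ ^ ((i : ℤ) - 1)‖ ≤ c * ‖τ‖ ^ J := by
  set κ : ℝ := Real.sqrt ((1 - Real.cos η) / 2) with hκdef
  have hcos : Real.cos η < 1 := by
    rw [← Real.cos_zero]
    exact Real.cos_lt_cos_of_nonneg_of_le_pi_div_two le_rfl hη'.le hη
  have hκ : 0 < κ := Real.sqrt_pos.mpr (by linarith)
  have hs1 : 1 < s.re := by linarith
  obtain ⟨ε, hε, hεα⟩ := exists_pos_le_abs_add_int α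
  obtain ⟨K, hK, H⟩ := norm_row_sub_main_le hs1 J (β := β)
    (taylorCoeff_recursion (hC ((Int.fract β : ℝ) : ℂ) ν)) hκ
  have hJ0 : (0 : ℝ) ≤ J := Nat.cast_nonneg J
  have hsum : Summable fun m : ℤ => |α + (m : ℝ)| ^ (-(s.re + J)) := by
    refine ((Real.summable_one_div_int_add_rpow α (s.re + J)).mpr (by linarith)).congr fun m => ?_
    rw [Real.rpow_neg (abs_nonneg _), one_div, add_comm]
  have hT : 0 ≤ ∑' m : ℤ, |α + (m : ℝ)| ^ (-(s.re + J)) := tsum_nonneg fun m => by positivity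
  refine ⟨K * (∑' m : ℤ, |α + (m : ℝ)| ^ (-(s.re + J))) + 1, by positivity, ε, hε,
    fun τ hτ hτε harg => ?_⟩
  have hcτ := le_norm_add_mul_I_mul hη hη' hτ harg
  have hre := re_pos_of_abs_arg_le hη hτ harg
  have hrows := (hasSum_Fz2_rows hs α β μ ν hτ hκ hcτ).sub
    (hasSum_main_rows hs α μ J (dInt β * (Complex.I * Complex.sin (Real.pi * s)))
      ((Complex.exp ((Real.pi : ℂ) * Complex.I * s / 2) * psiL s (-β) (-ν) +
        Complex.exp (-((Real.pi : ℂ) * Complex.I * s) / 2) * psiL s β ν) * τ ^ (-s))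
      (2 * Complex.sin (Real.pi * s))
      (fun i => C i ((Int.fract β : ℝ) : ℂ) ν * τ ^ ((i : ℤ) - 1))
      (fun i => Complex.I ^ i * (Complex.Gamma (s + ((i : ℂ) - 1)) / Complex.Gamma s) /
        (Nat.factorial i : ℂ)))
  have hbound := hrows.norm_le_of_bounded ((hsum.hasSum.mul_left (‖τ‖ ^ J)).mul_left K) fun m =>
    H τ (α + m) μ hre (fun hm => hτε.trans (hεα m hm)) hcτ
  have hτJ : 0 ≤ ‖τ‖ ^ J := by positivity
  refine le_trans (le_of_eq ?_) (hbound.trans (by nlinarith))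
  congr 1
  have hmul : ∀ i : ℕ, Complex.I ^ i * (Complex.Gamma (s + ((i : ℂ) - 1)) / Complex.Gamma s) /
      (Nat.factorial i : ℂ) * psiL (s + ((i : ℂ) - 1)) (-α) (-μ) *
        (C i ((Int.fract β : ℝ) : ℂ) ν * τ ^ ((i : ℤ) - 1)) =
      Complex.I ^ i * (Complex.Gamma (s + ((i : ℂ) - 1)) / Complex.Gamma s) /
      (Nat.factorial i : ℂ) * psiL (s + ((i : ℂ) - 1)) (-α) (-μ) *
        C i ((Int.fract β : ℝ) : ℂ) ν * τ ^ ((i : ℤ) - 1) := fun i => (mul_assoc _ _ _).symm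
  simp only [hmul]
  ring

end
end
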